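/- Let f satisfy (H); when f is singular assume additionally that F(t) → ∞ as t → a_f, where F(t) = ∫₀ᵗ f(s) ds. Let (u_m) be a sequence of semistable solutions of (N_{λ_m}). If sup_m ‖f̃(u_m)/√(F(u_m))‖_{L^q(Ω)} < ∞ for some q ≥ 1, where f̃(t) = f(t) − f(0), then sup_m ‖u_m‖_{L^∞(Ω)} < a_f whenever n < 2q. In particular, if sup_m ‖f'(u_m)‖_{L^q(Ω)} < ∞ then sup_m ‖u_m‖_{L^∞(Ω)} < a_f whenever n < 4q. -/

import Mathlib

open MeasureTheory Filter Topology Real Set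

noncomputable section

/-- The Laplacian of a real-valued function on Euclidean space. -/
def lap {n : ℕ} (u : EuclideanSpace ℝ (Fin n) → ℝ) (x : EuclideanSpace ℝ (Fin n)) : ℝ :=
  ∑ i : Fin n, iteratedFDeriv ℝ 2 u x ![EuclideanSpace.single i (1:ℝ), EuclideanSpace.single i (1:ℝ)]

/-- A bounded (smooth) domain. -/
def GoodDomain {n : ℕ} (Ω : Set (EuclideanSpace ℝ (Fin n))) : Prop :=
  IsOpen Ω ∧ Bornology.IsBounded Ω ∧ Ω.Nonempty

/-- The domain `[0, a_f)` of the nonlinearity. -/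
def domf (a : EReal) : Set ℝ := {t : ℝ | 0 ≤ t ∧ (t : EReal) < a}

/-- The filter of `t → a_f⁻`. -/
def afFilter (a : EReal) : Filter ℝ :=
  if a = ⊤ then Filter.atTop else nhdsWithin a.toReal (Set.Iio a.toReal)

/-- Hypothesis (H) on the nonlinearity `f : [0, a_f) → ℝ₊`. -/
structure HypH (a : EReal) (f : ℝ → ℝ) : Prop where
  a_pos : 0 < a
  smooth : ContDiffOn ℝ (⊤ : ℕ∞) f (domf a)
  mono : StrictMonoOn f (domf a)
  convex : ConvexOn ℝ (domf a) f
  f0_pos : 0 < f 0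
  pos : ∀ t ∈ domf a, 0 < f t
  blowup : Filter.Tendsto f (afFilter a) Filter.atTop
  superlinear : a = ⊤ → Filter.Tendsto (fun t => f t / t) Filter.atTop Filter.atTop

/-- `τ₋ = liminf_{t → a_f} f f'' / (f')²`. -/
def tauMinus (a : EReal) (f : ℝ → ℝ) : ℝ :=
  Filter.liminf (fun t => f t * deriv (deriv f) t / (deriv f t) ^ 2) (afFilter a)

/-- `τ₊ = limsup_{t → a_f} f f'' / (f')²`. -/
def tauPlus (a : EReal) (f : ℝ → ℝ) : ℝ :=
  Filter.limsup (fun t => f t * deriv (deriv f) t / (deriv f t) ^ 2) (afFilter a)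

/-- `u` is a (smooth, `[0,a_f)`-valued) solution of `Δ²u = λ f(u)` in `Ω`,
`u = Δu = 0` on `∂Ω`. -/
def Solves {n : ℕ} (Ω : Set (EuclideanSpace ℝ (Fin n))) (a : EReal) (lam : ℝ)
    (f : ℝ → ℝ) (u : EuclideanSpace ℝ (Fin n) → ℝ) : Prop :=
  ContDiff ℝ (⊤ : ℕ∞) u ∧ (∀ x ∈ Ω, 0 ≤ u x ∧ (u x : EReal) < a) ∧
  (∀ x ∈ Ω, lap (lap u) x = lam * f (u x)) ∧
  (∀ x ∈ frontier Ω, u x = 0) ∧ (∀ x ∈ frontier Ω, lap u x = 0)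

/-- `u` is a semistable solution: the second variation is nonnegative over
test functions in `H² ∩ H¹₀` (modelled by smooth functions vanishing on `∂Ω`). -/
def Semistable {n : ℕ} (Ω : Set (EuclideanSpace ℝ (Fin n))) (lam : ℝ)
    (f : ℝ → ℝ) (u : EuclideanSpace ℝ (Fin n) → ℝ) : Prop :=
  ∀ φ : EuclideanSpace ℝ (Fin n) → ℝ, ContDiff ℝ (⊤ : ℕ∞) φ → (∀ x ∈ frontier Ω, φ x = 0) →
    0 ≤ ∫ x in Ω, ((lap φ x) ^ 2 - lam * deriv f (u x) * (φ x) ^ 2)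

/-- `u` satisfies the stability inequality
`√λ ∫ √(f'(u)) φ² ≤ ∫ |∇φ|²` for all `φ ∈ H¹₀(Ω)`
(modelled by smooth compactly supported test functions). -/
def StabIneq {n : ℕ} (Ω : Set (EuclideanSpace ℝ (Fin n))) (lam : ℝ)
    (f : ℝ → ℝ) (u : EuclideanSpace ℝ (Fin n) → ℝ) : Prop :=
  ∀ φ : EuclideanSpace ℝ (Fin n) → ℝ, ContDiff ℝ (⊤ : ℕ∞) φ → HasCompactSupport φ →
    tsupport φ ⊆ Ω →
    Real.sqrt lam * ∫ x in Ω, Real.sqrt (deriv f (u x)) * (φ x) ^ 2 ≤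
      ∫ x in Ω, ‖gradient φ x‖ ^ 2

/-- The quartic polynomial `P_f(α, τ₋, τ₊)`. -/
def Pf (τm τp α : ℝ) : ℝ :=
  (2 - τm) ^ 2 * α ^ 4 - 8 * (2 - τp) * α ^ 2 + 4 * (4 - 3 * τp) * α - 4 * (1 - τp)

/-- `F(t) = ∫₀ᵗ f(s) ds`. -/
def Fint (f : ℝ → ℝ) (t : ℝ) : ℝ := ∫ s in (0:ℝ)..t, f s

/-- `f̃(t) = f(t) - f(0)`. -/
def ftil (f : ℝ → ℝ) (t : ℝ) : ℝ := f t - f 0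

/-- `Θ(t) = ∫₀ᵗ θ'(s)² ds`. -/
def Theta (θ : ℝ → ℝ) (t : ℝ) : ℝ := ∫ s in (0:ℝ)..t, (deriv θ s) ^ 2

/-- Partial derivative. -/
def pd {n : ℕ} (i : Fin n) (u : EuclideanSpace ℝ (Fin n) → ℝ) (x : EuclideanSpace ℝ (Fin n)) : ℝ :=
  fderiv ℝ u x (EuclideanSpace.single i (1:ℝ))

lemma pd_contDiff {n : ℕ} (i : Fin n) {u : EuclideanSpace ℝ (Fin n) → ℝ}
    (hu : ContDiff ℝ (⊤ : ℕ∞) u) : ContDiff ℝ (⊤ : ℕ∞) (pd i u) := by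
  have h : ContDiff ℝ (⊤ : ℕ∞) (fderiv ℝ u) := hu.fderiv_right (by simp)
  exact h.clm_apply contDiff_const

lemma smooth_differentiable {n : ℕ} {u : EuclideanSpace ℝ (Fin n) → ℝ}
    (hu : ContDiff ℝ (⊤ : ℕ∞) u) : Differentiable ℝ u := hu.differentiable (by simp)

lemma lap_eq {n : ℕ} {u : EuclideanSpace ℝ (Fin n) → ℝ}
    (hu : ContDiff ℝ (⊤ : ℕ∞) u) (x : EuclideanSpace ℝ (Fin n)) :
    lap u x = ∑ i : Fin n, pd i (pd i u) x := by
  unfold lap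
  refine Finset.sum_congr rfl fun i _ => ?_
  rw [iteratedFDeriv_two_apply]
  have h : ContDiff ℝ (⊤ : ℕ∞) (fderiv ℝ u) := hu.fderiv_right (by simp)
  have hd : DifferentiableAt ℝ (fderiv ℝ u) x := (h.differentiable (by simp)) x
  unfold pd
  rw [fderiv_clm_apply hd (differentiableAt_const _)]
  simp

lemma lap_contDiff {n : ℕ} {u : EuclideanSpace ℝ (Fin n) → ℝ}
    (hu : ContDiff ℝ (⊤ : ℕ∞) u) : ContDiff ℝ (⊤ : ℕ∞) (lap u) := by
  have : lap u = fun x => ∑ i : Fin n, pd i (pd i u) x := funext (lap_eq hu)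
  rw [this]
  exact ContDiff.sum fun i _ => pd_contDiff i (pd_contDiff i hu)

lemma lap_congr {n : ℕ} {u v : EuclideanSpace ℝ (Fin n) → ℝ} {x : EuclideanSpace ℝ (Fin n)}
    (h : u =ᶠ[𝓝 x] v) : lap u x = lap v x := by
  unfold lap
  rw [(h.iteratedFDeriv ℝ 2).eq_of_nhds]

lemma pd_lin {n : ℕ} (i : Fin n) {u v : EuclideanSpace ℝ (Fin n) → ℝ}
    (hu : ContDiff ℝ (⊤ : ℕ∞) u) (hv : ContDiff ℝ (⊤ : ℕ∞) v) (c d : ℝ) :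
    pd i (fun x => c * u x + d * v x) = fun x => c * pd i u x + d * pd i v x := by
  funext x
  have h1 := ((smooth_differentiable hu x).hasFDerivAt.const_mul c).add
    ((smooth_differentiable hv x).hasFDerivAt.const_mul d)
  unfold pd
  erw [h1.fderiv]
  simp

lemma lap_lin {n : ℕ} {u v : EuclideanSpace ℝ (Fin n) → ℝ}
    (hu : ContDiff ℝ (⊤ : ℕ∞) u) (hv : ContDiff ℝ (⊤ : ℕ∞) v) (c d : ℝ) (x) :
    lap (fun x => c * u x + d * v x) x = c * lap u x + d * lap v x := by
  have h : ContDiff ℝ (⊤ : ℕ∞) (fun x => c * u x + d * v x) :=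
    (contDiff_const.mul hu).add (contDiff_const.mul hv)
  rw [lap_eq h, lap_eq hu, lap_eq hv, Finset.mul_sum, Finset.mul_sum, ← Finset.sum_add_distrib]
  refine Finset.sum_congr rfl fun i _ => ?_
  rw [pd_lin i hu hv, pd_lin i (pd_contDiff i hu) (pd_contDiff i hv)]

lemma lap_neg {n : ℕ} {u : EuclideanSpace ℝ (Fin n) → ℝ}
    (hu : ContDiff ℝ (⊤ : ℕ∞) u) (x) :
    lap (fun x => - u x) x = - lap u x := by
  have := lap_lin hu hu (-1) 0 x
  simpa using this

/-- second derivative test at a local max -/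
lemma lap_nonpos_of_isLocalMax {n : ℕ} {u : EuclideanSpace ℝ (Fin n) → ℝ}
    (hu : ContDiff ℝ (⊤ : ℕ∞) u) {x : EuclideanSpace ℝ (Fin n)} (h : IsLocalMax u x) :
    lap u x ≤ 0 := by
  rw [lap_eq hu]
  refine Finset.sum_nonpos fun i _ => ?_
  set e : EuclideanSpace ℝ (Fin n) := EuclideanSpace.single i (1:ℝ) with he
  let ℓ : ℝ → EuclideanSpace ℝ (Fin n) := fun t => x + t • e
  have hℓ : ∀ t, HasDerivAt ℓ e t := fun t => by
    have := ((hasDerivAt_id t).smul_const e).const_add x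
    rw [one_smul] at this
    exact this
  have hl0 : ℓ 0 = x := by simp [ℓ]
  have key : ∀ w : EuclideanSpace ℝ (Fin n) → ℝ, ContDiff ℝ (⊤ : ℕ∞) w → 
      ∀ t, HasDerivAt (w ∘ ℓ) (pd i w (ℓ t)) t := fun w hw t => by
    exact (smooth_differentiable hw (ℓ t)).hasFDerivAt.comp_hasDerivAt t (hℓ t)
  have d1 : deriv (u ∘ ℓ) = pd i u ∘ ℓ := funext fun t => (key u hu t).deriv
  have d2 : deriv (deriv (u ∘ ℓ)) 0 = pd i (pd i u) x := by
    rw [d1, (key _ (pd_contDiff i hu) 0).deriv, hl0]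
  have hmax : IsLocalMax (u ∘ ℓ) 0 := by
    have hc : Tendsto ℓ (𝓝 0) (𝓝 x) := by
      have := (hℓ 0).continuousAt.tendsto
      rwa [hl0] at this
    have := hc.eventually h
    filter_upwards [this] with t ht
    simpa [hl0] using ht
  by_contra hcon
  push Not at hcon
  rw [← d2] at hcon
  have hmin := isLocalMin_of_deriv_deriv_pos hcon hmax.deriv_eq_zero (key u hu 0).continuousAt
  have hconst : (u ∘ ℓ) =ᶠ[𝓝 0] fun _ => (u ∘ ℓ) 0 := by
    filter_upwards [hmin, hmax] with t h1 h2
    exact le_antisymm h2 h1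
  have := hconst.deriv.deriv_eq
  rw [this] at hcon
  simp at hcon

lemma lap_nonneg_of_isLocalMin {n : ℕ} {u : EuclideanSpace ℝ (Fin n) → ℝ}
    (hu : ContDiff ℝ (⊤ : ℕ∞) u) {x : EuclideanSpace ℝ (Fin n)} (h : IsLocalMin u x) :
    0 ≤ lap u x := by
  have := lap_nonpos_of_isLocalMax hu.neg (x := x) h.neg
  have h2 := lap_neg hu x
  change lap (fun x => - u x) x ≤ 0 at this
  linarith

/-- Integration by parts -/
lemma green_symm {n : ℕ} {u ψ : EuclideanSpace ℝ (Fin n) → ℝ}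
    (hu : ContDiff ℝ (⊤ : ℕ∞) u) (hψ : ContDiff ℝ (⊤ : ℕ∞) ψ) (hc : HasCompactSupport ψ) :
    ∫ x, ψ x * lap u x = ∫ x, u x * lap ψ x := by
  have hcp : ∀ i, HasCompactSupport (pd i ψ) := fun i => 
    hc.fderiv_apply (𝕜 := ℝ) (v := EuclideanSpace.single i (1:ℝ))
  have hcpp : ∀ i, HasCompactSupport (pd i (pd i ψ)) := fun i => 
    (hcp i).fderiv_apply (𝕜 := ℝ) (v := EuclideanSpace.single i (1:ℝ))
  have hI : ∀ (a b : EuclideanSpace ℝ (Fin n) → ℝ), ContDiff ℝ (⊤ : ℕ∞) a → 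
      ContDiff ℝ (⊤ : ℕ∞) b → HasCompactSupport a → Integrable (fun x => a x * b x) := 
    fun a b ha hb hac => (ha.continuous.mul hb.continuous).integrable_of_hasCompactSupport
      hac.mul_right
  have e1 : ∀ x, ψ x * lap u x = ∑ i, ψ x * pd i (pd i u) x := fun x => by
    rw [lap_eq hu, Finset.mul_sum]
  have e2 : ∀ x, u x * lap ψ x = ∑ i, pd i (pd i ψ) x * u x := fun x => by
    rw [lap_eq hψ, Finset.mul_sum]
    exact Finset.sum_congr rfl fun i _ => mul_comm _ _
  simp_rw [e1, e2]
  rw [integral_finsetSum, integral_finsetSum]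
  · refine Finset.sum_congr rfl fun i _ => ?_
    have a1 := pd_contDiff i hu
    have a2 := pd_contDiff i hψ
    have s1 : ∫ x, ψ x * pd i (pd i u) x = - ∫ x, pd i ψ x * pd i u x := by
      apply integral_mul_fderiv_eq_neg_fderiv_mul_of_integrable
      · exact hI _ _ a2 a1 (hcp i)
      · exact hI _ _ hψ (pd_contDiff i a1) hc
      · exact hI _ _ hψ a1 hc
      · exact fun x _ => smooth_differentiable hψ x
      · exact fun x _ => smooth_differentiable a1 x
    have s2 : ∫ x, pd i ψ x * pd i u x = - ∫ x, pd i (pd i ψ) x * u x := by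
      apply integral_mul_fderiv_eq_neg_fderiv_mul_of_integrable
      · exact hI _ _ (pd_contDiff i a2) hu (hcpp i)
      · exact hI _ _ a2 a1 (hcp i)
      · exact hI _ _ a2 hu (hcp i)
      · exact fun x _ => smooth_differentiable a2 x
      · exact fun x _ => smooth_differentiable hu x
    rw [s1, s2, neg_neg]
  · exact fun i _ => hI _ _ (pd_contDiff i (pd_contDiff i hψ)) hu (hcpp i)
  · exact fun i _ => hI _ _ hψ (pd_contDiff i (pd_contDiff i hu)) hc

/-- convex cut-off function -/
lemma exists_eta (ε : ℝ) (hε : 0 < ε) : ∃ η : ℝ → ℝ, ContDiff ℝ (⊤ : ℕ∞) η ∧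
    (∀ t ≤ ε, η t = 0) ∧ (∀ t, 0 ≤ deriv η t ∧ deriv η t ≤ 1) ∧ (∀ t, 0 ≤ deriv (deriv η) t) ∧
    (∀ t, 0 ≤ t → 0 ≤ η t ∧ η t ≤ t ∧ t - 2 * ε ≤ η t) := by
  let k : ℝ → ℝ := fun s => Real.smoothTransition (s / ε - 1)
  have hk : ContDiff ℝ (⊤ : ℕ∞) k := 
    Real.smoothTransition.contDiff.comp ((contDiff_id.div_const ε).sub contDiff_const)
  have hkm : Monotone k := fun x y h => Real.smoothTransition.monotone (by gcongr)
  have hk0 : ∀ s ≤ ε, k s = 0 := fun s hs => Real.smoothTransition.zero_of_nonpos (by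
    have : s / ε ≤ 1 := (div_le_one hε).2 hs
    linarith)
  have hk1 : ∀ s, 2 * ε ≤ s → k s = 1 := fun s hs => Real.smoothTransition.one_of_one_le (by
    have : 2 ≤ s / ε := (le_div_iff₀ hε).2 hs
    linarith)
  let η : ℝ → ℝ := fun t => ∫ s in ε..t, k s
  have hd : ∀ t, HasDerivAt η (k t) t := fun t => 
    (hk.continuous.integral_hasStrictDerivAt ε t).hasDerivAt
  have hd' : deriv η = k := funext fun t => (hd t).deriv
  have hη : ContDiff ℝ (⊤ : ℕ∞) η := by
    rw [contDiff_infty_iff_deriv]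
    exact ⟨fun t => (hd t).differentiableAt, hd' ▸ hk⟩
  have hmono : Monotone η := monotone_of_deriv_nonneg (fun t => (hd t).differentiableAt)
    (fun t => by rw [hd']; exact Real.smoothTransition.nonneg _)
  have h0 : ∀ t ≤ ε, η t = 0 := fun t ht => by
    have : ∫ s in ε..t, k s = ∫ s in ε..t, (0:ℝ) := by
      apply intervalIntegral.integral_congr
      intro s hs
      rw [uIcc_of_ge ht] at hs
      exact hk0 s hs.2
    simp [η, this]
  have anti : Antitone (fun t => η t - t) := antitone_of_deriv_nonpos 
    (fun t => ((hd t).sub (hasDerivAt_id t)).differentiableAt) (fun t => by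
      have := ((hd t).sub (hasDerivAt_id t)).deriv
      change deriv (fun t => η t - t) t = _ at this
      rw [this]
      have : k t ≤ 1 := Real.smoothTransition.le_one _
      linarith)
  refine ⟨η, hη, h0, fun t => ?_, fun t => ?_, fun t ht => ⟨?_, ?_, ?_⟩⟩
  · rw [hd']; exact ⟨Real.smoothTransition.nonneg _, Real.smoothTransition.le_one _⟩
  · rw [hd']; exact hkm.deriv_nonneg
  · have := hmono ht
    rwa [h0 0 hε.le] at this
  · have := anti ht
    simp only [h0 0 hε.le] at this
    linarith
  · rcases le_total t (2 * ε) with h | h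
    · have := hmono ht
      rw [h0 0 hε.le] at this
      linarith
    · have h3 : η t = η (2 * ε) + ∫ s in (2*ε)..t, k s := by
        simp only [η]
        rw [intervalIntegral.integral_add_adjacent_intervals] <;>
        exact hk.continuous.intervalIntegrable _ _
      have h4 : ∫ s in (2*ε)..t, k s = ∫ s in (2*ε)..t, (1:ℝ) := by
        apply intervalIntegral.integral_congr
        intro s hs
        rw [uIcc_of_le h] at hs
        exact hk1 s hs.1
      have := hmono (show (0:ℝ) ≤ 2 * ε by linarith)
      rw [h0 0 hε.le] at this
      rw [h3, h4]
      simp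
      linarith

lemma pd_comp {n : ℕ} (i : Fin n) {η : ℝ → ℝ} (hη : ContDiff ℝ (⊤ : ℕ∞) η)
    {v : EuclideanSpace ℝ (Fin n) → ℝ} (hv : ContDiff ℝ (⊤ : ℕ∞) v) :
    pd i (fun x => η (v x)) = fun x => deriv η (v x) * pd i v x := by
  funext x
  have h1 : HasDerivAt η (deriv η (v x)) (v x) := (hη.differentiable (by simp) _).hasDerivAt
  have := h1.comp_hasFDerivAt x (smooth_differentiable hv x).hasFDerivAt
  unfold pd
  erw [this.fderiv]
  simp

lemma pd_mul {n : ℕ} (i : Fin n) {u v : EuclideanSpace ℝ (Fin n) → ℝ}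
    (hu : ContDiff ℝ (⊤ : ℕ∞) u)  (hv : ContDiff ℝ (⊤ : ℕ∞) v) (x) :
    pd i (fun x => u x * v x) x = u x * pd i v x + pd i u x * v x := by
  have := (smooth_differentiable hu x).hasFDerivAt.mul (smooth_differentiable hv x).hasFDerivAt
  unfold pd
  erw [this.fderiv]
  simp [mul_comm]

lemma lap_comp {n : ℕ} {η : ℝ → ℝ} (hη : ContDiff ℝ (⊤ : ℕ∞) η)
    {v : EuclideanSpace ℝ (Fin n) → ℝ} (hv : ContDiff ℝ (⊤ : ℕ∞) v) (x) :
    lap (fun x => η (v x)) x = deriv η (v x) * lap v x + 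
      deriv (deriv η) (v x) * ∑ i, (pd i v x) ^ 2 := by
  have h : ContDiff ℝ (⊤ : ℕ∞) (fun x => η (v x)) := hη.comp hv
  have hη' : ContDiff ℝ (⊤ : ℕ∞) (deriv η) := (contDiff_infty_iff_deriv.1 hη).2
  rw [lap_eq h, lap_eq hv, Finset.mul_sum, Finset.mul_sum, ← Finset.sum_add_distrib]
  refine Finset.sum_congr rfl fun i _ => ?_
  rw [pd_comp i hη hv, pd_mul i (u := fun x => deriv η (v x)) (hη'.comp hv) (pd_contDiff i hv), pd_comp i hη' hv]
  ring

/-- cutoff of a function vanishing on the boundary -/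
lemma exists_cut {n : ℕ} {Ω : Set (EuclideanSpace ℝ (Fin n))} (hΩ : GoodDomain Ω)
    {v : EuclideanSpace ℝ (Fin n) → ℝ} (hv : ContDiff ℝ (⊤ : ℕ∞) v)
    (hb : ∀ x ∈ frontier Ω, v x = 0) (hpos : ∀ x ∈ Ω, 0 ≤ v x) (ε : ℝ) (hε : 0 < ε) :
    ∃ ψ : EuclideanSpace ℝ (Fin n) → ℝ, ContDiff ℝ (⊤ : ℕ∞) ψ ∧ HasCompactSupport ψ ∧
      (∀ x ∉ Ω, ψ x = 0 ∧ lap ψ x = 0) ∧ 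
      (∀ x ∈ Ω, 0 ≤ ψ x ∧ ψ x ≤ v x ∧ v x - 2 * ε ≤ ψ x) ∧
      (∀ x ∈ Ω, ∃ c : ℝ, 0 ≤ c ∧ c ≤ 1 ∧ c * lap v x ≤ lap ψ x) := by
  obtain ⟨ho, hbd, -⟩ := hΩ
  obtain ⟨η, hη, h0, h1, h2, h3⟩ := exists_eta ε hε
  classical
  let ψ : EuclideanSpace ℝ (Fin n) → ℝ := fun x => if x ∈ Ω then η (v x) else 0
  have hin : ∀ x ∈ Ω, ψ =ᶠ[𝓝 x] fun x => η (v x) := fun x hx => by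
    filter_upwards [ho.mem_nhds hx] with y hy
    simp [ψ, hy]
  have hout : ∀ x ∉ Ω, ψ =ᶠ[𝓝 x] fun _ => 0 := fun x hx => by
    by_cases hxc : x ∈ closure Ω
    · have hf : x ∈ frontier Ω := ⟨hxc, by rwa [ho.interior_eq]⟩
      have : ∀ᶠ y in 𝓝 x, v y < ε := 
        hv.continuous.continuousAt.eventually_lt continuousAt_const (by rw [hb x hf]; exact hε)
      filter_upwards [this] with y hy
      simp only [ψ]
      split_ifs
      · exact h0 _ hy.le
      · rfl
    · filter_upwards [isClosed_closure.isOpen_compl.mem_nhds hxc] with y hy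
      have : y ∉ Ω := fun h => hy (subset_closure h)
      simp [ψ, this]
  refine ⟨ψ, ?_, ?_, ?_, ?_, ?_⟩
  · rw [contDiff_iff_contDiffAt]
    intro x
    by_cases hx : x ∈ Ω
    · exact (hη.comp hv).contDiffAt.congr_of_eventuallyEq (hin x hx)
    · exact contDiffAt_const.congr_of_eventuallyEq (hout x hx)
  · refine HasCompactSupport.intro (K := closure Ω) ?_ ?_
    · exact hbd.isCompact_closure
    · intro x hx
      have : x ∉ Ω := fun h => hx (subset_closure h)
      simp [ψ, this]
  · intro x hx
    refine ⟨by simp [ψ, hx], ?_⟩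
    rw [lap_congr (hout x hx)]
    have := lap_lin (contDiff_const (c := (0:ℝ))) (contDiff_const (c := (0:ℝ))) 0 0 x
    simpa using this
  · intro x hx
    simpa [ψ, hx] using h3 (v x) (hpos x hx)
  · intro x hx
    refine ⟨deriv η (v x), (h1 _).1, (h1 _).2, ?_⟩
    rw [lap_congr (hin x hx), lap_comp hη hv]
    have := mul_nonneg (h2 (v x)) (Finset.sum_nonneg fun i (_ : i ∈ Finset.univ) => sq_nonneg (pd i v x))
    linarith

/-- Gaussian weight. -/
def gau {n : ℕ} (y : EuclideanSpace ℝ (Fin n)) : ℝ := Real.exp (-(‖y‖ ^ 2) / 2)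

lemma gau_contDiff {n : ℕ} : ContDiff ℝ (⊤ : ℕ∞) (gau (n := n)) := by
  unfold gau
  exact Real.contDiff_exp.comp (((contDiff_norm_sq ℝ).neg).div_const 2)

lemma gau_pos {n : ℕ} (y : EuclideanSpace ℝ (Fin n)) : 0 < gau y := Real.exp_pos _

lemma gau_le_one {n : ℕ} (y : EuclideanSpace ℝ (Fin n)) : gau y ≤ 1 := by
  unfold gau
  rw [Real.exp_le_one_iff]
  have := sq_nonneg ‖y‖
  linarith

lemma integrable_exp_aux {n : ℕ} (b : ℝ) (hb : 0 < b) :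
    Integrable (fun y : EuclideanSpace ℝ (Fin n) => Real.exp (-b * ‖y‖ ^ 2)) := by
  have := (GaussianFourier.integrable_cexp_neg_mul_sq_norm_add (V := EuclideanSpace ℝ (Fin n))
    (b := (b : ℂ)) (by simpa using hb) 0 0).norm
  refine this.congr (Eventually.of_forall fun y => ?_)
  simp only [Complex.norm_exp]
  congr 1
  simp [← Complex.ofReal_pow]

lemma gau_integrable {n : ℕ} : Integrable (gau (n := n)) := by
  refine (integrable_exp_aux (n := n) (1/2) (by norm_num)).congr (Eventually.of_forall fun y => ?_)
  simp only [gau]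
  congr 1
  ring

lemma gau_integral_pos {n : ℕ} : 0 < ∫ y, gau (n := n) y := by
  rw [integral_pos_iff_support_of_nonneg (fun y => (gau_pos y).le) gau_integrable]
  have : Function.support (gau (n := n)) = univ := by
    ext y; simp [(gau_pos y).ne']
  rw [this]
  exact isOpen_univ.measure_pos volume univ_nonempty

lemma norm_gau_integrable {n : ℕ} : 
    Integrable (fun y : EuclideanSpace ℝ (Fin n) => ‖y‖ * gau y) := by
  refine (integrable_exp_aux (n := n) (1/4) (by norm_num)).mono' ?_ (Eventually.of_forall fun y => ?_)
  · exact (continuous_norm.mul gau_contDiff.continuous).aestronglyMeasurable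
  · rw [Real.norm_of_nonneg (mul_nonneg (norm_nonneg _) (gau_pos y).le)]
    have h1 : ‖y‖ ≤ Real.exp (‖y‖ ^ 2 / 4) := by
      have := Real.add_one_le_exp (‖y‖ ^ 2 / 4)
      nlinarith [sq_nonneg (‖y‖ - 2)]
    calc ‖y‖ * gau y ≤ Real.exp (‖y‖ ^ 2 / 4) * gau y := by
          gcongr
          exact (gau_pos y).le
      _ = _ := by
          unfold gau
          rw [← Real.exp_add]
          congr 1
          ring

lemma pd_gau {n : ℕ} (i : Fin n) (y : EuclideanSpace ℝ (Fin n)) : pd i gau y = - (y i * gau y) := by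
  have h1 := (hasStrictFDerivAt_norm_sq y).hasFDerivAt
  have h2 : HasFDerivAt (fun y : EuclideanSpace ℝ (Fin n) => -(‖y‖^2) / 2) 
    ((-1/2 : ℝ) • (2 • (innerSL ℝ) y)) y := by
    have := h1.const_mul (-1/2 : ℝ)
    refine this.congr_of_eventuallyEq (Eventually.of_forall fun z => ?_)
    simp only
    ring
  have h3 := h2.exp
  unfold pd
  erw [h3.fderiv]
  simp [gau, EuclideanSpace.inner_single_right]
  ring

lemma affine_hasFDerivAt {n : ℕ} (x₀ : EuclideanSpace ℝ (Fin n)) (s : ℝ) (y) :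
    HasFDerivAt (fun y : EuclideanSpace ℝ (Fin n) => x₀ + s • y) 
      (s • ContinuousLinearMap.id ℝ (EuclideanSpace ℝ (Fin n))) y :=
  ((hasFDerivAt_id y).const_smul s).const_add x₀

lemma affine_contDiff {n : ℕ} (x₀ : EuclideanSpace ℝ (Fin n)) (s : ℝ) :
    ContDiff ℝ (⊤ : ℕ∞) (fun y : EuclideanSpace ℝ (Fin n) => x₀ + s • y) :=
  contDiff_const.add (contDiff_id.const_smul s)

lemma pd_affine {n : ℕ} (i : Fin n) {w : EuclideanSpace ℝ (Fin n) → ℝ}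
    (hw : ContDiff ℝ (⊤ : ℕ∞) w) (x₀) (s : ℝ) (y) :
    pd i (fun y => w (x₀ + s • y)) y = s * pd i w (x₀ + s • y) := by
  have := (smooth_differentiable hw (x₀ + s • y)).hasFDerivAt.comp y (affine_hasFDerivAt x₀ s y)
  unfold pd
  erw [this.fderiv]
  simp

lemma scale_integral {n : ℕ} (h : EuclideanSpace ℝ (Fin n) → ℝ) (x₀) {s : ℝ} (hs : 0 < s) :
    ∫ y, h (x₀ + s • y) = (s ^ n)⁻¹ * ∫ y, h y := by
  have := Measure.integral_comp_smul_of_nonneg volume (fun z => h (x₀ + z)) s (hR := hs.le)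
  rw [this, integral_add_left_eq_self h x₀]
  simp

lemma scale_integrable {n : ℕ} {h : EuclideanSpace ℝ (Fin n) → ℝ} (hh : Integrable h) (x₀) {s : ℝ} 
    (hs : 0 < s) : Integrable (fun y => h (x₀ + s • y)) :=
  Integrable.comp_smul (f := fun z => h (x₀ + z)) (hh.comp_add_left x₀) hs.ne'

lemma scale_compact {n : ℕ} {h : EuclideanSpace ℝ (Fin n) → ℝ} (hh : HasCompactSupport h) (x₀) {s : ℝ} 
    (hs : 0 < s) : HasCompactSupport (fun y => h (x₀ + s • y)) := by
  have e : (fun y => h (x₀ + s • y)) = 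
    h ∘ ((Homeomorph.smulOfNeZero s hs.ne').trans (Homeomorph.addLeft x₀)) := by
    funext y; simp
  rw [e]
  exact hh.comp_homeomorph _

lemma A_deriv {n : ℕ} {ψ : EuclideanSpace ℝ (Fin n) → ℝ} (hψ : ContDiff ℝ (⊤ : ℕ∞) ψ) 
    (hc : HasCompactSupport ψ) (x₀) (s : ℝ) :
    Integrable (fun y => fderiv ℝ ψ (x₀ + s • y) y * gau y) ∧ 
    HasDerivAt (fun s : ℝ => ∫ y, ψ (x₀ + s • y) * gau y) 
      (∫ y, fderiv ℝ ψ (x₀ + s • y) y * gau y) s := by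
  have hfd : ContDiff ℝ (⊤ : ℕ∞) (fderiv ℝ ψ) := hψ.fderiv_right (by simp)
  obtain ⟨C, hC⟩ := (hc.fderiv (𝕜 := ℝ)).exists_bound_of_continuous hfd.continuous
  obtain ⟨C0, hC0⟩ := hc.exists_bound_of_continuous hψ.continuous
  have hcont : ∀ s : ℝ, Continuous (fun y => ψ (x₀ + s • y) * gau y) := fun s =>
    (hψ.continuous.comp (affine_contDiff x₀ s).continuous).mul gau_contDiff.continuous
  refine hasDerivAt_integral_of_dominated_loc_of_deriv_le (s := univ) 
    (F := fun (s : ℝ) y => ψ (x₀ + s • y) * gau y)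
    (F' := fun s y => fderiv ℝ ψ (x₀ + s • y) y * gau y)
    (bound := fun y => C * (‖y‖ * gau y)) univ_mem ?_ ?_ ?_ ?_ ?_ ?_
  · exact Eventually.of_forall fun s => (hcont s).aestronglyMeasurable
  · refine (gau_integrable.const_mul C0).mono' (hcont s).aestronglyMeasurable 
      (Eventually.of_forall fun y => ?_)
    rw [norm_mul, Real.norm_of_nonneg (gau_pos y).le]
    exact mul_le_mul_of_nonneg_right (hC0 _) (gau_pos y).le
  · refine Continuous.aestronglyMeasurable ?_
    exact ((hfd.continuous.comp (affine_contDiff x₀ s).continuous).clm_apply continuous_id).mul 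
      gau_contDiff.continuous
  · refine Eventually.of_forall fun y s _ => ?_
    rw [norm_mul, Real.norm_of_nonneg (gau_pos y).le, ← mul_assoc]
    refine mul_le_mul_of_nonneg_right ?_ (gau_pos y).le
    exact (ContinuousLinearMap.le_opNorm _ _).trans 
      (mul_le_mul_of_nonneg_right (hC _) (norm_nonneg _))
  · exact norm_gau_integrable.const_mul C
  · refine Eventually.of_forall fun y s _ => ?_
    have h1 : HasDerivAt (fun s : ℝ => x₀ + s • y) y s := by
      have := ((hasDerivAt_id s).smul_const y).const_add x₀
      rw [one_smul] at this
      exact this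
    exact ((smooth_differentiable hψ (x₀ + s • y)).hasFDerivAt.comp_hasDerivAt s h1).mul_const _

lemma A_deriv_eq {n : ℕ} {ψ : EuclideanSpace ℝ (Fin n) → ℝ} (hψ : ContDiff ℝ (⊤ : ℕ∞) ψ) 
    (hc : HasCompactSupport ψ) (x₀) {s : ℝ} (hs : 0 < s) :
    ∫ y, fderiv ℝ ψ (x₀ + s • y) y * gau y = s * ∫ y, lap ψ (x₀ + s • y) * gau y := by
  have hcp : ∀ i, HasCompactSupport (pd i ψ) := fun i => 
    hc.fderiv_apply (𝕜 := ℝ) (v := EuclideanSpace.single i (1:ℝ))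
  have hcpp : ∀ i, HasCompactSupport (pd i (pd i ψ)) := fun i => 
    (hcp i).fderiv_apply (𝕜 := ℝ) (v := EuclideanSpace.single i (1:ℝ))
  have e1 : ∀ y, fderiv ℝ ψ (x₀ + s • y) y * gau y = 
      ∑ i, -(pd i ψ (x₀ + s • y) * pd i gau y) := fun y => by
    have hy : y = ∑ i, y i • EuclideanSpace.single i (1:ℝ) := by
      ext j
      simp [Finset.sum_apply, Pi.single_apply]
    have : fderiv ℝ ψ (x₀ + s • y) y = ∑ i, y i * pd i ψ (x₀ + s • y) := by
      conv_lhs => arg 2; rw [hy]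
      rw [map_sum]
      simp [pd]
    rw [this, Finset.sum_mul]
    refine Finset.sum_congr rfl fun i _ => ?_
    rw [pd_gau]; ring
  have e2 : ∀ y, lap ψ (x₀ + s • y) * gau y = ∑ i, pd i (pd i ψ) (x₀ + s • y) * gau y := fun y => by
    rw [lap_eq hψ, Finset.sum_mul]
  have hI : ∀ (a b : EuclideanSpace ℝ (Fin n) → ℝ), Continuous a → 
      Continuous b → HasCompactSupport a → Integrable (fun x => a x * b x) := 
    fun a b ha hb hac => (ha.mul hb).integrable_of_hasCompactSupport hac.mul_right
  have sc : ∀ w : EuclideanSpace ℝ (Fin n) → ℝ, ContDiff ℝ (⊤ : ℕ∞) w →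
    ContDiff ℝ (⊤ : ℕ∞) (fun y => w (x₀ + s • y)) := fun w hw => hw.comp (affine_contDiff x₀ s)
  have hgc := (gau_contDiff (n := n)).continuous
  simp_rw [e1, e2]
  rw [integral_finsetSum, integral_finsetSum, Finset.mul_sum]
  · refine Finset.sum_congr rfl fun i _ => ?_
    have hp := pd_contDiff i hψ
    have hpp := pd_contDiff i hp
    rw [integral_neg, ← integral_const_mul]
    have := integral_mul_fderiv_eq_neg_fderiv_mul_of_integrable (μ := volume) (𝕜 := ℝ)
      (f := fun y => pd i ψ (x₀ + s • y)) (g := gau) (v := EuclideanSpace.single i (1:ℝ)) 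
      ?_ ?_ ?_ ?_ ?_
    · have h2 : ∫ y, pd i ψ (x₀ + s • y) * pd i gau y = 
        - ∫ y, pd i (fun y => pd i ψ (x₀ + s • y)) y * gau y := this
      rw [h2, neg_neg]
      refine integral_congr_ae (Eventually.of_forall fun y => ?_)
      simp only
      rw [pd_affine i hp]; ring
    · have : (fun y => (fderiv ℝ (fun y => pd i ψ (x₀ + s • y)) y) (EuclideanSpace.single i 1) * gau y)
        = fun y => (s * pd i (pd i ψ) (x₀ + s • y)) * gau y := by
        funext y
        rw [← pd_affine i hp]; rfl
      rw [this]
      exact hI _ _ (continuous_const.mul (sc _ hpp).continuous) hgc 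
        (scale_compact (hcpp i) x₀ hs).mul_left
    · exact hI _ _ (sc _ hp).continuous (pd_contDiff i gau_contDiff).continuous 
        (scale_compact (hcp i) x₀ hs)
    · exact hI _ _ (sc _ hp).continuous hgc (scale_compact (hcp i) x₀ hs)
    · exact fun x _ => smooth_differentiable (sc _ hp) x
    · exact fun x _ => smooth_differentiable gau_contDiff x
  · exact fun i _ => hI _ _ (sc _ (pd_contDiff i (pd_contDiff i hψ))).continuous hgc 
      (scale_compact (hcpp i) x₀ hs)
  · exact fun i _ => (hI _ _ (sc _ (pd_contDiff i hψ)).continuous 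
      (pd_contDiff i gau_contDiff).continuous (scale_compact (hcp i) x₀ hs)).neg

lemma young_aux {h k q : ℝ} (hh : 0 ≤ h) (hk : 0 < k) (hq : 1 ≤ q) :
    h ≤ k + k ^ (1 - q) * h ^ q := by
  rcases le_total h k with h1 | h1
  · have : 0 ≤ k ^ (1 - q) * h ^ q := by positivity
    linarith
  · have hp : 0 < h := hk.trans_le h1
    have : h = h ^ (1 - q) * h ^ q := by
      rw [← Real.rpow_add hp]; simp
    have h2 : h ^ (1 - q) ≤ k ^ (1 - q) := 
      Real.rpow_le_rpow_of_nonpos hk h1 (by linarith)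
    have : h ^ (1 - q) * h ^ q ≤ k ^ (1 - q) * h ^ q := by gcongr
    linarith

lemma potential {n : ℕ} {q : ℝ} (hq : 1 ≤ q) (hnq : (n : ℝ) < 2 * q) 
    {ψ : EuclideanSpace ℝ (Fin n) → ℝ} (hψ : ContDiff ℝ (⊤ : ℕ∞) ψ) 
    (hc : HasCompactSupport ψ) {J : ℝ} (hJ : 0 < J) 
    (hJψ : ∫ x, (max (- lap ψ x) 0) ^ q ≤ J ^ q) (x₀) {S : ℝ} (hS : 0 < S) :
    (∫ y, gau (n := n) y) * ψ x₀ ≤ (∫ y, ψ (x₀ + S • y) * gau y) + 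
      (((∫ y, gau (n := n) y) + 1) / (2 - n / q)) * S ^ (2 - n / q) * J := by
  set Z := ∫ y, gau (n := n) y with hZ
  have hZp : 0 < Z := gau_integral_pos
  have hq0 : 0 < q := by linarith
  set θ := 2 - n / q with hθ
  have hθp : 0 < θ := by
    have : n / q < 2 := by rw [div_lt_iff₀ hq0]; linarith
    rw [hθ]; linarith
  let H : EuclideanSpace ℝ (Fin n) → ℝ := fun x => max (- lap ψ x) 0
  have hH0 : ∀ x, 0 ≤ H x := fun x => le_max_right _ _
  have hHc : Continuous H := (lap_contDiff hψ).continuous.neg.max continuous_const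
  have hlc : HasCompactSupport (lap ψ) := by
    refine HasCompactSupport.intro hc fun x hx => ?_
    have h0 : ψ =ᶠ[𝓝 x] fun _ => 0 := notMem_tsupport_iff_eventuallyEq.1 hx
    rw [lap_congr h0]
    have := lap_lin (contDiff_const (c := (0:ℝ))) (contDiff_const (c := (0:ℝ))) 0 0 x
    simpa using this
  have hHs : HasCompactSupport H := by
    have := hlc.comp_left (g := fun t => max (-t) 0) (by simp)
    exact this
  have hHq : Integrable (fun x => H x ^ q) := by
    refine Continuous.integrable_of_hasCompactSupport (hHc.rpow_const fun x => Or.inr hq0.le) ?_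
    exact hHs.comp_left (g := fun t => t ^ q) (by simp [hq0.ne'])
  let A : ℝ → ℝ := fun s => ∫ y, ψ (x₀ + s • y) * gau y
  have hA : ∀ s, HasDerivAt A (∫ y, fderiv ℝ ψ (x₀ + s • y) y * gau y) s := 
    fun s => (A_deriv hψ hc x₀ s).2
  have key : ∀ s, 0 < s → -((Z + 1) * J * s ^ (θ - 1)) ≤ 
      ∫ y, fderiv ℝ ψ (x₀ + s • y) y * gau y := by
    intro s hs
    rw [A_deriv_eq hψ hc x₀ hs]
    set k := J * s ^ (-(n / q : ℝ)) with hk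
    have hkp : 0 < k := by positivity
    have i1 : Integrable (fun y => H (x₀ + s • y) ^ q) := scale_integrable hHq x₀ hs
    have i2 : Integrable (fun y => k * gau (n := n) y + k ^ (1 - q) * H (x₀ + s • y) ^ q) := 
      (gau_integrable.const_mul k).add (i1.const_mul _)
    have i3 : Integrable (fun y => lap ψ (x₀ + s • y) * gau y) := by
      refine Continuous.integrable_of_hasCompactSupport ?_ (scale_compact hlc x₀ hs).mul_right
      exact ((lap_contDiff hψ).continuous.comp (affine_contDiff x₀ s).continuous).mul 
        gau_contDiff.continuous
    have b1 : ∫ y, -(lap ψ (x₀ + s • y) * gau y) ≤ 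
        ∫ y, (k * gau (n := n) y + k ^ (1 - q) * H (x₀ + s • y) ^ q) := by
      refine integral_mono i3.neg i2 fun y => ?_
      have c1 : -lap ψ (x₀ + s • y) ≤ H (x₀ + s • y) := le_max_left _ _
      have c2 := young_aux (hH0 (x₀ + s • y)) hkp hq
      have g0 := gau_pos y
      have g1 := gau_le_one y
      have c3 : 0 ≤ k ^ (1 - q) * H (x₀ + s • y) ^ q := 
        mul_nonneg (by positivity) (Real.rpow_nonneg (hH0 _) _)
      simp only
      nlinarith
    rw [integral_neg, integral_add (gau_integrable.const_mul k) (i1.const_mul _), 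
      integral_const_mul, integral_const_mul, scale_integral (fun x => H x ^ q) x₀ hs, ← hZ] at b1
    have b2 : k ^ (1 - q) * ((s ^ n)⁻¹ * ∫ x, H x ^ q) ≤ k := by
      have : k ^ (1 - q) * ((s ^ n)⁻¹ * ∫ x, H x ^ q) ≤ k ^ (1 - q) * ((s ^ n)⁻¹ * J ^ q) := by
        gcongr
      refine this.trans (le_of_eq ?_)
      have h1 : (s ^ n)⁻¹ * J ^ q = k ^ q := by
        rw [hk, Real.mul_rpow hJ.le (by positivity), ← Real.rpow_mul hs.le]
        have : -(n / q : ℝ) * q = -(n : ℝ) := by field_simp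
        rw [this, Real.rpow_neg hs.le, Real.rpow_natCast, mul_comm]
      rw [h1, ← Real.rpow_add hkp]
      simp
    have b3 : s * k = J * s ^ (θ - 1) := by
      have : θ - 1 = 1 + -(n / q : ℝ) := by rw [hθ]; ring
      rw [this, Real.rpow_add hs, Real.rpow_one, hk]; ring
    have b4 : -(∫ y, lap ψ (x₀ + s • y) * gau y) ≤ k * (Z + 1) := by linarith
    have b5 := mul_le_mul_of_nonneg_left b4 hs.le
    have b6 : s * (k * (Z+1)) = (Z + 1) * J * s ^ (θ - 1) := by
      rw [← mul_assoc, b3]; ring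
    linarith
  let B : ℝ → ℝ := fun s => A s + ((Z + 1) / θ) * s ^ θ * J
  have hB : ∀ s, 0 < s → HasDerivAt B ((∫ y, fderiv ℝ ψ (x₀ + s • y) y * gau y) + 
      ((Z + 1) / θ) * (θ * s ^ (θ - 1)) * J) s := fun s hs => by
    exact (hA s).add (((Real.hasDerivAt_rpow_const (Or.inl hs.ne')).const_mul _).mul_const _)
  have hmono : MonotoneOn B (Ici 0) := by
    refine monotoneOn_of_deriv_nonneg (convex_Ici 0) ?_ ?_ ?_
    · refine ContinuousOn.add ?_ ?_
      · exact fun s _ => (hA s).continuousAt.continuousWithinAt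
      · refine ContinuousOn.mul (ContinuousOn.mul continuousOn_const ?_) continuousOn_const
        exact (Real.continuous_rpow_const hθp.le).continuousOn
    · intro s hs
      rw [interior_Ici] at hs
      exact (hB s hs).differentiableAt.differentiableWithinAt
    · intro s hs
      rw [interior_Ici] at hs
      rw [(hB s hs).deriv]
      have := key s hs
      have e : ((Z + 1) / θ) * (θ * s ^ (θ - 1)) * J = (Z + 1) * J * s ^ (θ - 1) := by
        field_simp
      rw [e]; linarith
  have := hmono (mem_Ici.2 le_rfl) (mem_Ici.2 hS.le) hS.le
  have h0 : B 0 = Z * ψ x₀ := by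
    simp only [B, A, Real.zero_rpow hθp.ne', zero_smul, add_zero, integral_const_mul]
    rw [← hZ]; ring
  rw [h0] at this
  exact this

/-- Sup estimate for functions vanishing on the boundary. -/
lemma sup_est {n : ℕ} {Ω : Set (EuclideanSpace ℝ (Fin n))} (hΩ : GoodDomain Ω)
    {q : ℝ} (hq : 1 ≤ q) (hnq : (n : ℝ) < 2 * q) 
    {v : EuclideanSpace ℝ (Fin n) → ℝ} (hv : ContDiff ℝ (⊤ : ℕ∞) v)
    (hb : ∀ x ∈ frontier Ω, v x = 0) (hpos : ∀ x ∈ Ω, 0 ≤ v x) 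
    {h : EuclideanSpace ℝ (Fin n) → ℝ} (hh : ∀ x ∈ Ω, 0 ≤ h x) (hvh : ∀ x ∈ Ω, - lap v x ≤ h x)
    (hintg : IntegrableOn (fun x => h x ^ q) Ω) {J : ℝ} (hJ : 0 < J)
    (hhJ : ∫ x in Ω, h x ^ q ≤ J ^ q) {x₀} (hx₀ : x₀ ∈ Ω) {S : ℝ} (hS : 0 < S) :
    (∫ y, gau (n := n) y) * v x₀ ≤ (S ^ n)⁻¹ * (∫ x in Ω, v x) + 
      (((∫ y, gau (n := n) y) + 1) / (2 - n / q)) * S ^ (2 - n / q) * J := by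
  have hq0 : 0 < q := by linarith
  have hZp : 0 < ∫ y, gau (n := n) y := gau_integral_pos
  have hmeas : MeasurableSet Ω := hΩ.1.measurableSet
  have hvint : IntegrableOn v Ω := 
    (hv.continuous.continuousOn.integrableOn_compact hΩ.2.1.isCompact_closure).mono_set subset_closure
  refine le_of_forall_pos_le_add fun δ hδ => ?_
  obtain ⟨ψ, hψ, hc, hout, hin, hlap⟩ := exists_cut hΩ hv hb hpos (δ / (2 * ∫ y, gau (n := n) y)) 
    (by positivity)
  have hψ0 : ∀ x, 0 ≤ ψ x := fun x => by
    by_cases hx : x ∈ Ω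
    · exact (hin x hx).1
    · rw [(hout x hx).1]
  have e1 : ∫ x, (max (- lap ψ x) 0) ^ q ≤ J ^ q := by
    refine le_trans ?_ hhJ
    rw [← integral_indicator hmeas]
    refine integral_mono_of_nonneg (Eventually.of_forall fun x => by positivity) 
      (hintg.integrable_indicator hmeas) (Eventually.of_forall fun x => ?_)
    by_cases hx : x ∈ Ω
    · simp only [indicator_of_mem hx]
      refine Real.rpow_le_rpow (le_max_right _ _) (max_le ?_ (hh x hx)) hq0.le
      obtain ⟨c, c0, c1, hcl⟩ := hlap x hx
      have h1 := hvh x hx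
      have h2 := hh x hx
      nlinarith
    · simp only [indicator_of_notMem hx, (hout x hx).2]
      simp [hq0.ne']
  have e2 := potential hq hnq hψ hc hJ e1 x₀ hS
  have hψi : Integrable ψ := hψ.continuous.integrable_of_hasCompactSupport hc
  have e3 : ∫ y, ψ (x₀ + S • y) * gau y ≤ (S ^ n)⁻¹ * (∫ x in Ω, v x) := by
    calc ∫ y, ψ (x₀ + S • y) * gau y ≤ ∫ y, ψ (x₀ + S • y) := by
          refine integral_mono_of_nonneg (Eventually.of_forall fun x => mul_nonneg (hψ0 _) (gau_pos _).le)
            (scale_integrable hψi x₀ hS) (Eventually.of_forall fun y => ?_)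
          exact mul_le_of_le_one_right (hψ0 _) (gau_le_one _)
      _ = (S ^ n)⁻¹ * ∫ x, ψ x := scale_integral ψ x₀ hS
      _ ≤ _ := by
          gcongr
          rw [← integral_indicator hmeas]
          refine integral_mono hψi (hvint.integrable_indicator hmeas) fun x => ?_
          by_cases hx : x ∈ Ω
          · simp only [indicator_of_mem hx]; exact (hin x hx).2.1
          · simp only [indicator_of_notMem hx, (hout x hx).1]; exact le_rfl
  have e4 := (hin x₀ hx₀).2.2
  have e5 := mul_le_mul_of_nonneg_left e4 hZp.le
  have e6 : (∫ y, gau (n := n) y) * (v x₀ - 2 * (δ / (2 * ∫ y, gau (n := n) y))) = 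
      (∫ y, gau (n := n) y) * v x₀ - δ := by
    field_simp
  rw [e6] at e5
  linarith

/-- Energy inequality. -/
lemma energy_le {n : ℕ} {Ω : Set (EuclideanSpace ℝ (Fin n))} (hΩ : GoodDomain Ω)
    {u v : EuclideanSpace ℝ (Fin n) → ℝ} (hu : ContDiff ℝ (⊤ : ℕ∞) u) (hv : ContDiff ℝ (⊤ : ℕ∞) v)
    (hb : ∀ x ∈ frontier Ω, v x = 0) (hpos : ∀ x ∈ Ω, 0 ≤ v x) (hupos : ∀ x ∈ Ω, 0 ≤ u x)
    (huv : ∀ x ∈ Ω, lap u x = - v x) (hvn : ∀ x ∈ Ω, lap v x ≤ 0) :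
    ∫ x in Ω, v x ^ 2 ≤ ∫ x in Ω, u x * (- lap v x) := by
  have hmeas : MeasurableSet Ω := hΩ.1.measurableSet
  have ion : ∀ w : EuclideanSpace ℝ (Fin n) → ℝ, Continuous w → IntegrableOn w Ω := fun w hw =>
    (hw.continuousOn.integrableOn_compact hΩ.2.1.isCompact_closure).mono_set subset_closure
  have key : ∀ ε : ℝ, 0 < ε → ∫ x in Ω, v x ^ 2 ≤ (∫ x in Ω, u x * (- lap v x)) + 
      ε * (2 * ∫ x in Ω, v x) := by
    intro ε hε
    obtain ⟨ψ, hψ, hc, hout, hin, hlap⟩ := exists_cut hΩ hv hb hpos ε hε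
    have g := green_symm hu hψ hc
    rw [← setIntegral_eq_integral_of_forall_compl_eq_zero (s := Ω) 
        (fun x hx => by rw [(hout x hx).1, zero_mul]),
      ← setIntegral_eq_integral_of_forall_compl_eq_zero (s := Ω) (f := fun x => u x * lap ψ x)
        (fun x hx => by rw [(hout x hx).2, mul_zero])] at g
    have hlψ := (lap_contDiff hψ).continuous
    have hlv := (lap_contDiff hv).continuous
    have hlu := (lap_contDiff hu).continuous
    have i1 : ∫ x in Ω, u x * lap v x ≤ ∫ x in Ω, u x * lap ψ x := by
      refine setIntegral_mono_on (ion _ (hu.continuous.mul hlv)) (ion _ (hu.continuous.mul hlψ)) 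
        hmeas fun x hx => ?_
      obtain ⟨c, c0, c1, hcl⟩ := hlap x hx
      refine mul_le_mul_of_nonneg_left ?_ (hupos x hx)
      have := hvn x hx
      nlinarith
    have i2 : ∫ x in Ω, ψ x * lap u x ≤ ∫ x in Ω, (2 * ε * v x - v x ^ 2) := by
      refine setIntegral_mono_on (ion _ (hψ.continuous.mul hlu)) 
        (ion _ ((continuous_const.mul hv.continuous).sub (hv.continuous.pow 2))) hmeas fun x hx => ?_
      rw [huv x hx]
      have h1 := (hin x hx).2.2
      have h2 := hpos x hx
      nlinarith
    rw [integral_sub (ion (fun x => 2 * ε * v x) (continuous_const.mul hv.continuous))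
      (ion (fun x => v x ^ 2) (hv.continuous.pow 2)),
      integral_const_mul] at i2
    have i3 : ∫ x in Ω, u x * (- lap v x) = - ∫ x in Ω, u x * lap v x := by
      rw [← integral_neg]; simp
    linarith
  have hlim : Tendsto (fun ε : ℝ => (∫ x in Ω, u x * (- lap v x)) + 
      ε * (2 * ∫ x in Ω, v x)) (𝓝[>] 0) (𝓝 ((∫ x in Ω, u x * (- lap v x)) + 
      0 * (2 * ∫ x in Ω, v x))) := by
    refine tendsto_nhdsWithin_of_tendsto_nhds ?_
    exact (Continuous.tendsto (by fun_prop) 0)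
  have := ge_of_tendsto hlim (eventually_nhdsWithin_of_forall fun ε hε => key ε hε)
  simpa using this

lemma tangent_ineq {D : Set ℝ} {R : ℝ → ℝ} (hR : ConvexOn ℝ D R) {t s R' : ℝ} (ht : t ∈ D)
    (hs : s ∈ D) (hd : HasDerivAt R R' t) : R t + R' * (s - t) ≤ R s := by
  rcases lt_trichotomy s t with h | h | h
  · have := hR.slope_le_of_hasDerivAt hs ht h hd
    rw [slope_def_field, div_le_iff₀ (by linarith)] at this
    linarith
  · subst h; simp
  · have := hR.le_slope_of_hasDerivAt ht hs h hd
    rw [slope_def_field, le_div_iff₀ (by linarith)] at this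
    linarith

lemma domf_down {a : EReal} {s t : ℝ} (ht : t ∈ domf a) (hs : 0 ≤ s) (hst : s ≤ t) : s ∈ domf a :=
  ⟨hs, lt_of_le_of_lt (by exact_mod_cast hst) ht.2⟩

lemma domf_nhds {a : EReal} {t : ℝ} (ht : t ∈ domf a) (h0 : 0 < t) : domf a ∈ 𝓝 t := by
  have h1 : ∀ᶠ s : ℝ in 𝓝 t, (s : EReal) < a := 
    continuous_coe_real_ereal.continuousAt.eventually_lt continuousAt_const ht.2
  filter_upwards [h1, lt_mem_nhds h0] with s hs hs0
  exact ⟨hs0.le, hs⟩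

lemma domf_interior {a : EReal} {t : ℝ} : t ∈ interior (domf a) ↔ t ∈ domf a ∧ 0 < t := by
  constructor
  · intro h
    refine ⟨interior_subset h, ?_⟩
    have h1 : domf a ⊆ Ici 0 := fun s hs => hs.1
    have := interior_mono h1 h
    rwa [interior_Ici] at this
  · rintro ⟨h, h0⟩
    exact mem_interior_iff_mem_nhds.2 (domf_nhds h h0)

lemma zero_mem_domf {a : EReal} {f : ℝ → ℝ} (hf : HypH a f) : (0:ℝ) ∈ domf a := 
  ⟨le_rfl, by exact_mod_cast hf.a_pos⟩

lemma f_hasDerivAt {a : EReal} {f : ℝ → ℝ} (hf : HypH a f) {t : ℝ} (ht : t ∈ domf a) (h0 : 0 < t) :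
    HasDerivAt f (deriv f t) t := by
  have := (hf.smooth.contDiffAt (domf_nhds ht h0)).differentiableAt (by simp)
  exact this.hasDerivAt

lemma f_tangent {a : EReal} {f : ℝ → ℝ} (hf : HypH a f) {t s : ℝ} (ht : t ∈ domf a) (h0 : 0 < t) 
    (hs : s ∈ domf a) : f t + deriv f t * (s - t) ≤ f s :=
  tangent_ineq hf.convex ht hs (f_hasDerivAt hf ht h0)

lemma deriv_mono {a : EReal} {f : ℝ → ℝ} (hf : HypH a f) {t s : ℝ} (ht : t ∈ domf a) (hs : 0 < s)
    (hst : s ≤ t) : deriv f s ≤ deriv f t := by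
  rcases hst.eq_or_lt with rfl | h
  · exact le_rfl
  have hs' := domf_down ht hs.le hst
  have h1 := f_tangent hf ht (hs.trans h) hs'
  have h2 := f_tangent hf hs' hs ht
  nlinarith

lemma deriv_nn {a : EReal} {f : ℝ → ℝ} (hf : HypH a f) {t : ℝ} (ht : t ∈ domf a) (h0 : 0 < t) :
    0 ≤ deriv f t := by
  have h1 := f_tangent hf ht h0 (zero_mem_domf hf)
  have h2 := hf.mono (zero_mem_domf hf) ht h0
  nlinarith

/-- the primitive of `ftil`. -/
def Ftil (f : ℝ → ℝ) (t : ℝ) : ℝ := Fint f t - f 0 * t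

lemma f_contOn_Icc {a : EReal} {f : ℝ → ℝ} (hf : HypH a f) {t : ℝ} (ht : t ∈ domf a) : 
    ContinuousOn f (Icc 0 t) :=
  hf.smooth.continuousOn.mono fun _ hs => domf_down ht hs.1 hs.2

lemma Ftil_hasDerivAt {a : EReal} {f : ℝ → ℝ} (hf : HypH a f) {t : ℝ} (ht : t ∈ domf a) (h0 : 0 < t) :
    HasDerivAt (Ftil f) (ftil f t) t := by
  have h1 : HasDerivAt (Fint f) (f t) t := by
    apply intervalIntegral.integral_hasDerivAt_right
    · refine ContinuousOn.intervalIntegrable ?_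
      rw [uIcc_of_le h0.le]
      exact f_contOn_Icc hf ht
    · exact (hf.smooth.continuousOn.mono interior_subset).stronglyMeasurableAtFilter isOpen_interior t
        (domf_interior.2 ⟨ht, h0⟩)
    · exact (f_hasDerivAt hf ht h0).continuousAt
  have := h1.sub ((hasDerivAt_id t).const_mul (f 0))
  rw [mul_one] at this
  exact this

lemma Ftil_contOn {a : EReal} {f : ℝ → ℝ} (hf : HypH a f) {t : ℝ} (ht : t ∈ domf a) :
    ContinuousOn (Ftil f) (Icc 0 t) := by
  refine ContinuousOn.sub ?_ (by fun_prop)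
  have := intervalIntegral.continuousOn_primitive_interval (f := f) (a := 0) (b := t) (μ := volume) (by
    rw [uIcc_of_le ht.1]
    exact (f_contOn_Icc hf ht).integrableOn_Icc)
  rwa [uIcc_of_le ht.1] at this

lemma Ftil_zero (f : ℝ → ℝ) : Ftil f 0 = 0 := by simp [Ftil, Fint]

lemma ftil_pos {a : EReal} {f : ℝ → ℝ} (hf : HypH a f) {t : ℝ} (ht : t ∈ domf a) (h0 : 0 < t) :
    0 < ftil f t := by
  have := hf.mono (zero_mem_domf hf) ht h0
  unfold ftil; linarith

lemma Ftil_pos {a : EReal} {f : ℝ → ℝ} (hf : HypH a f) {t : ℝ} (ht : t ∈ domf a) (h0 : 0 < t) :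
    0 < Ftil f t := by
  have : StrictMonoOn (Ftil f) (Icc 0 t) := by
    refine strictMonoOn_of_deriv_pos (convex_Icc 0 t) (Ftil_contOn hf ht) fun s hs => ?_
    rw [interior_Icc] at hs
    have hs' := domf_down ht hs.1.le hs.2.le
    rw [(Ftil_hasDerivAt hf hs' hs.1).deriv]
    exact ftil_pos hf hs' hs.1
  have := this (left_mem_Icc.2 h0.le) (right_mem_Icc.2 h0.le) h0
  rwa [Ftil_zero] at this

lemma Ftil_nonneg {a : EReal} {f : ℝ → ℝ} (hf : HypH a f) {t : ℝ} (ht : t ∈ domf a) :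
    0 ≤ Ftil f t := by
  rcases ht.1.eq_or_lt with h | h
  · rw [← h, Ftil_zero]
  · exact (Ftil_pos hf ht h).le

lemma Fint_eq (f : ℝ → ℝ) (t : ℝ) : Fint f t = Ftil f t + f 0 * t := by unfold Ftil; ring

lemma ftil_hasDerivAt {a : EReal} {f : ℝ → ℝ} (hf : HypH a f) {t : ℝ} (ht : t ∈ domf a) (h0 : 0 < t) :
    HasDerivAt (ftil f) (deriv f t) t := (f_hasDerivAt hf ht h0).sub_const _

lemma ftil_sq_le {a : EReal} {f : ℝ → ℝ} (hf : HypH a f) {t : ℝ} (ht : t ∈ domf a) (h0 : 0 < t) :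
    ftil f t ^ 2 ≤ 2 * Ftil f t * deriv f t := by
  have hd : ∀ s ∈ Ioo 0 t, HasDerivAt (fun s => 2 * Ftil f s * deriv f t - ftil f s ^ 2) 
      (2 * ftil f s * deriv f t - 2 * ftil f s * deriv f s) s := fun s hs => by
    have hs' := domf_down ht hs.1.le hs.2.le
    have := (((Ftil_hasDerivAt hf hs' hs.1).const_mul 2).mul_const (deriv f t)).sub
      ((ftil_hasDerivAt hf hs' hs.1).pow 2)
    convert! this using 1
    simp
  have : MonotoneOn (fun s => 2 * Ftil f s * deriv f t - ftil f s ^ 2) (Icc 0 t) := by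
    refine monotoneOn_of_deriv_nonneg (convex_Icc 0 t) ?_ ?_ fun s hs => ?_
    · refine ContinuousOn.sub ((continuousOn_const.mul (Ftil_contOn hf ht)).mul continuousOn_const) ?_
      exact ((f_contOn_Icc hf ht).sub continuousOn_const).pow 2
    · intro s hs
      rw [interior_Icc] at hs
      exact (hd s hs).differentiableAt.differentiableWithinAt
    · rw [interior_Icc] at hs
      rw [(hd s hs).deriv]
      have h1 := deriv_mono hf ht hs.1 hs.2.le
      have h2 := ftil_pos hf (domf_down ht hs.1.le hs.2.le) hs.1
      nlinarith
  have := this (left_mem_Icc.2 h0.le) (right_mem_Icc.2 h0.le) h0.le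
  simp only [Ftil_zero] at this
  have e : ftil f 0 = 0 := by simp [ftil]
  rw [e] at this
  linarith

/-- `√(2 F̃)`. -/
def Rf (f : ℝ → ℝ) (t : ℝ) : ℝ := √(2 * Ftil f t)

lemma Rf_pos {a : EReal} {f : ℝ → ℝ} (hf : HypH a f) {t : ℝ} (ht : t ∈ domf a) (h0 : 0 < t) :
    0 < Rf f t := Real.sqrt_pos.2 (by have := Ftil_pos hf ht h0; linarith)

lemma Rf_sq {a : EReal} {f : ℝ → ℝ} (hf : HypH a f) {t : ℝ} (ht : t ∈ domf a) :
    Rf f t ^ 2 = 2 * Ftil f t := Real.sq_sqrt (by have := Ftil_nonneg hf ht; linarith)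

lemma Rf_hasDerivAt {a : EReal} {f : ℝ → ℝ} (hf : HypH a f) {t : ℝ} (ht : t ∈ domf a) (h0 : 0 < t) :
    HasDerivAt (Rf f) (ftil f t / Rf f t) t := by
  have := ((Ftil_hasDerivAt hf ht h0).const_mul 2).sqrt (by have := Ftil_pos hf ht h0; positivity)
  convert! this using 1
  change _ = 2 * ftil f t / (2 * Rf f t)
  have := Rf_pos hf ht h0
  field_simp

lemma domf_convex (a : EReal) : Convex ℝ (domf a) := by
  refine OrdConnected.convex ⟨fun x hx y hy z hz => ?_⟩
  exact domf_down hy (hx.1.trans hz.1) hz.2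

lemma Rf_contOn {a : EReal} {f : ℝ → ℝ} (hf : HypH a f) : ContinuousOn (Rf f) (domf a) := by
  intro t ht
  rcases ht.1.eq_or_lt with h | h
  · by_cases hex : ∃ b ∈ domf a, 0 < b
    · obtain ⟨b, hb, hb0⟩ := hex
      have h1 : ContinuousOn (Rf f) (Icc 0 b) := 
        (continuousOn_const.mul (Ftil_contOn hf hb)).sqrt
      have h2 := h1 t ⟨ht.1, by linarith⟩
      refine h2.mono_of_mem_nhdsWithin ?_
      have : Iio b ∈ 𝓝 t := Iio_mem_nhds (by linarith)
      filter_upwards [mem_nhdsWithin_of_mem_nhds this, self_mem_nhdsWithin] with s hs hs'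
      exact ⟨hs'.1, hs.le⟩
    · push Not at hex
      have : domf a ⊆ {t} := fun s hs => by
        have := hex s hs
        have := hs.1
        simp; linarith
      exact (continuousWithinAt_singleton (f := Rf f) (x := t)).mono this
  · exact (Rf_hasDerivAt hf ht h).continuousAt.continuousWithinAt

lemma Rf_convexOn {a : EReal} {f : ℝ → ℝ} (hf : HypH a f) : ConvexOn ℝ (domf a) (Rf f) := by
  have hmono : MonotoneOn (fun t => ftil f t / Rf f t) (interior (domf a)) := by
    have hd : ∀ t ∈ interior (domf a), HasDerivAt (fun t => ftil f t / Rf f t) 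
        ((deriv f t * Rf f t - ftil f t * (ftil f t / Rf f t)) / Rf f t ^ 2) t := fun t ht => by
      obtain ⟨h1, h2⟩ := domf_interior.1 ht
      exact (ftil_hasDerivAt hf h1 h2).div (Rf_hasDerivAt hf h1 h2) (Rf_pos hf h1 h2).ne'
    refine monotoneOn_of_deriv_nonneg (domf_convex a).interior ?_ ?_ ?_
    · exact fun t ht => (hd t ht).continuousAt.continuousWithinAt
    · rw [interior_interior]
      exact fun t ht => (hd t ht).differentiableAt.differentiableWithinAt
    · rw [interior_interior]
      intro t ht
      rw [(hd t ht).deriv]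
      obtain ⟨h1, h2⟩ := domf_interior.1 ht
      have hR := Rf_pos hf h1 h2
      refine div_nonneg ?_ (sq_nonneg _)
      have := ftil_sq_le hf h1 h2
      have h3 := Rf_sq hf h1
      have : ftil f t * (ftil f t / Rf f t) ≤ deriv f t * Rf f t := by
        rw [← mul_div_assoc, div_le_iff₀ hR]
        rw [← h3] at this
        linarith
      linarith
  refine MonotoneOn.convexOn_of_deriv (domf_convex a) ?_ ?_ ?_
  · exact Rf_contOn hf
  · intro t ht
    obtain ⟨h1, h2⟩ := domf_interior.1 ht
    exact (Rf_hasDerivAt hf h1 h2).differentiableAt.differentiableWithinAt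
  · refine hmono.congr fun t ht => ?_
    obtain ⟨h1, h2⟩ := domf_interior.1 ht
    exact (Rf_hasDerivAt hf h1 h2).deriv.symm

lemma Rf_tangent {a : EReal} {f : ℝ → ℝ} (hf : HypH a f) {t s : ℝ} (ht : t ∈ domf a) (h0 : 0 < t) 
    (hs : s ∈ domf a) : Rf f t + ftil f t / Rf f t * (s - t) ≤ Rf f s :=
  tangent_ineq (Rf_convexOn hf) ht hs (Rf_hasDerivAt hf ht h0)

lemma a_cases {a : EReal} {f : ℝ → ℝ} (hf : HypH a f) : a = ⊤ ∨ ∃ b : ℝ, 0 < b ∧ a = (b : EReal) := by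
  induction a using EReal.rec with
  | bot => exact absurd hf.a_pos (by simp)
  | coe b => exact Or.inr ⟨b, by exact_mod_cast hf.a_pos, rfl⟩
  | top => exact Or.inl rfl

lemma exists_K {a : EReal} {f : ℝ → ℝ} (hf : HypH a f) : 
    ∃ K : ℝ, 0 ≤ K ∧ ∀ t ∈ domf a, t ≤ Ftil f t + K := by
  rcases a_cases hf with rfl | ⟨b, hb, rfl⟩
  · have h1 := hf.blowup
    simp only [afFilter, if_true] at h1
    obtain ⟨T, hT⟩ := eventually_atTop.1 (h1.eventually_ge_atTop (f 0 + 1))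
    set T' := max T 0 with hT'
    have hD : ∀ t : ℝ, 0 ≤ t → t ∈ domf ⊤ := fun t ht => ⟨ht, EReal.coe_lt_top t⟩
    refine ⟨T', le_max_right _ _, fun t ht => ?_⟩
    rcases le_total t T' with h | h
    · have := Ftil_nonneg hf ht; linarith
    · have hm : MonotoneOn (fun s => Ftil f s - s) (Icc T' t) := by
        have hd : ∀ s ∈ Ioo T' t, HasDerivAt (fun s => Ftil f s - s) (ftil f s - 1) s := fun s hs =>
          (Ftil_hasDerivAt hf (hD s (le_trans (le_max_right _ _) hs.1.le)) 
            (lt_of_le_of_lt (le_max_right _ _) hs.1)).sub (hasDerivAt_id s)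
        refine monotoneOn_of_deriv_nonneg (convex_Icc _ _) ?_ ?_ fun s hs => ?_
        · exact ((Ftil_contOn hf ht).mono (Icc_subset_Icc_left (le_max_right _ _))).sub continuousOn_id
        · rw [interior_Icc]
          exact fun s hs => (hd s hs).differentiableAt.differentiableWithinAt
        · rw [interior_Icc] at hs
          rw [(hd s hs).deriv]
          have := hT s ((le_max_left _ _).trans hs.1.le)
          unfold ftil; linarith
      have := hm (left_mem_Icc.2 h) (right_mem_Icc.2 h) h
      simp only at this
      have h3 := Ftil_nonneg hf (hD T' (le_max_right _ _))
      linarith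
  · refine ⟨b, hb.le, fun t ht => ?_⟩
    have h1 := Ftil_nonneg hf ht
    have h2 : t < b := by exact_mod_cast ht.2
    linarith

lemma f_le {a : EReal} {f : ℝ → ℝ} (hf : HypH a f) :
    ∃ c : ℝ, 0 < c ∧ ∀ t ∈ domf a, 0 < t → 
      f t ≤ c * (1 + ftil f t / √(Fint f t)) * (1 + Rf f t) := by
  obtain ⟨K, hK, hKt⟩ := exists_K hf
  have hf0 := hf.f0_pos
  set c := (1 + f 0) * (1 + K) with hc
  have hc1 : 1 ≤ c := by rw [hc]; nlinarith
  refine ⟨c, by linarith, fun t ht h0 => ?_⟩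
  have hR := Rf_pos hf ht h0
  have hR2 := Rf_sq hf ht
  have hFt := Ftil_pos hf ht h0
  have hF : 0 < Fint f t := by rw [Fint_eq]; positivity
  have hs : √(Fint f t) ≤ c * (1 + Rf f t) := by
    rw [Real.sqrt_le_left (by positivity)]
    have h1 : Fint f t ≤ c * (1 + Ftil f t) := by
      rw [Fint_eq, hc]
      have := mul_le_mul_of_nonneg_left (hKt t ht) hf0.le
      have : 0 ≤ K * Ftil f t := by positivity
      have : 0 ≤ f 0 * (K * Ftil f t) := by positivity
      nlinarith
    have h2 : 1 + Ftil f t ≤ (1 + Rf f t) ^ 2 := by nlinarith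
    calc Fint f t ≤ c * (1 + Ftil f t) := h1
      _ ≤ c * (1 + Rf f t)^2 := by gcongr
      _ ≤ c ^ 2 * (1 + Rf f t)^2 := by
        gcongr; nlinarith
      _ = _ := by ring
  have hg : 0 ≤ ftil f t / √(Fint f t) := div_nonneg (ftil_pos hf ht h0).le (Real.sqrt_nonneg _)
  have e : ftil f t = ftil f t / √(Fint f t) * √(Fint f t) := by
    have := (Real.sqrt_pos.2 hF).ne'
    field_simp
  have e2 : f t = f 0 + ftil f t := by unfold ftil; ring
  have h3 : ftil f t ≤ ftil f t / √(Fint f t) * (c * (1 + Rf f t)) := by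
    conv_lhs => rw [e]
    gcongr
  have h4 : f 0 ≤ c := by rw [hc]; nlinarith
  have h5 : 0 ≤ c * Rf f t := by positivity
  calc f t = f 0 + ftil f t := e2
    _ ≤ c * (1 + Rf f t) + ftil f t / √(Fint f t) * (c * (1 + Rf f t)) := by linarith
    _ = _ := by ring

lemma Ftil_bdd {a : EReal} {f : ℝ → ℝ} (hf : HypH a f) 
    (hF : a ≠ ⊤ → Filter.Tendsto (Fint f) (afFilter a) Filter.atTop) (B : ℝ) : 
    ∃ C : ℝ, (C : EReal) < a ∧ ∀ t ∈ domf a, Ftil f t ≤ B → t ≤ C := by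
  rcases a_cases hf with rfl | ⟨b, hb, rfl⟩
  · obtain ⟨K, hK, hKt⟩ := exists_K hf
    refine ⟨B + K, EReal.coe_lt_top _, fun t ht h => ?_⟩
    have := hKt t ht
    linarith
  · have h1 := hF (EReal.coe_ne_top b)
    simp only [afFilter, EReal.coe_ne_top, if_false, EReal.toReal_coe] at h1
    have h2 := h1.eventually_gt_atTop (B + f 0 * b)
    obtain ⟨C, hC, hCs⟩ := (mem_nhdsLT_iff_exists_Ioo_subset).1 h2
    refine ⟨C, by exact_mod_cast hC, fun t ht h => ?_⟩
    by_contra hcon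
    push Not at hcon
    have htb : t < b := by exact_mod_cast ht.2
    have h3 : B + f 0 * b < Fint f t := hCs ⟨hcon, htb⟩
    rw [Fint_eq] at h3
    have := hf.f0_pos
    nlinarith

lemma t_le {a : EReal} {f : ℝ → ℝ} (hf : HypH a f) :
    ∃ K : ℝ, 0 ≤ K ∧ ∀ t ∈ domf a, 0 < t → t ≤ K + (deriv f t * t ^ 2 - t * f t) := by
  have hf0 := hf.f0_pos
  have base : ∀ t ∈ domf a, 0 < t → - (f 0) * t ≤ deriv f t * t ^ 2 - t * f t := fun t ht h0 => by
    have := f_tangent hf ht h0 (zero_mem_domf hf)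
    nlinarith
  rcases a_cases hf with rfl | ⟨b, hb, rfl⟩
  · have hD : ∀ t : ℝ, 0 ≤ t → t ∈ domf ⊤ := fun t ht => ⟨ht, EReal.coe_lt_top t⟩
    have hsl := hf.superlinear rfl
    obtain ⟨T, hT⟩ := eventually_atTop.1 (hsl.eventually_ge_atTop (f 0 + f 1 + 1))
    set T' := max T 1 with hT'
    have hT1 : 1 ≤ T' := le_max_right _ _
    refine ⟨(1 + f 0) * T', by positivity, fun t ht h0 => ?_⟩
    rcases le_total t T' with h | h
    · have := base t ht h0
      nlinarith
    · have h1 := hT t ((le_max_left _ _).trans h)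
      have ht1 : 1 ≤ t := hT1.trans h
      rw [le_div_iff₀ h0] at h1
      have h2 := f_tangent hf ht h0 (zero_mem_domf hf)
      have h3 := f_tangent hf ht h0 (hD 1 zero_le_one)
      have h4 : f 1 + 1 ≤ deriv f t := by
        have : (f 1 + 1) * t ≤ deriv f t * t := by nlinarith
        exact le_of_mul_le_mul_right this h0
      have h5 : 1 ≤ deriv f t * t - f t := by nlinarith
      have : 0 ≤ (1 + f 0) * T' := by positivity
      nlinarith
  · refine ⟨(1 + f 0) * b, by positivity, fun t ht h0 => ?_⟩
    have := base t ht h0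
    have h2 : t < b := by exact_mod_cast ht.2
    nlinarith

lemma g_sq_le {a : EReal} {f : ℝ → ℝ} (hf : HypH a f) {t : ℝ} (ht : t ∈ domf a) (h0 : 0 < t) :
    (ftil f t / √(Fint f t)) ^ 2 ≤ 2 * deriv f t := by
  have hf0 := hf.f0_pos
  have hFt := Ftil_pos hf ht h0
  have hF : 0 < Fint f t := by rw [Fint_eq]; positivity
  rw [div_pow, Real.sq_sqrt hF.le, div_le_iff₀ hF, Fint_eq]
  have h1 := ftil_sq_le hf ht h0
  have h2 := deriv_nn hf ht h0
  have : 0 ≤ deriv f t * (f 0 * t) := by positivity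
  nlinarith

lemma mem_of_closure {n : ℕ} {Ω : Set (EuclideanSpace ℝ (Fin n))} (hΩ : GoodDomain Ω) {x}
    (hx : x ∈ closure Ω) : x ∈ Ω ∨ x ∈ frontier Ω := by
  by_cases h : x ∈ Ω
  · exact Or.inl h
  · exact Or.inr ⟨hx, by rwa [hΩ.1.interior_eq]⟩

/-- Basic pointwise facts on a solution. -/
lemma sol_facts {n : ℕ} {Ω : Set (EuclideanSpace ℝ (Fin n))} (hΩ : GoodDomain Ω)
    {a : EReal} {f : ℝ → ℝ} (hf : HypH a f) {lam : ℝ} (hlam : 0 < lam)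
    {u : EuclideanSpace ℝ (Fin n) → ℝ} (hs : Solves Ω a lam f u) :
    ∃ v : EuclideanSpace ℝ (Fin n) → ℝ, ContDiff ℝ (⊤ : ℕ∞) v ∧ (∀ x, lap u x = - v x) ∧
      (∀ x ∈ frontier Ω, v x = 0) ∧ (∀ x ∈ Ω, - lap v x = lam * f (u x)) ∧ 
      (∀ x ∈ Ω, 0 < u x) ∧ (∀ x ∈ Ω, u x ∈ domf a) ∧ (∀ x ∈ Ω, √lam * Rf f (u x) ≤ v x) ∧
      (∃ T ∈ domf a, 0 < T ∧ ∀ x ∈ Ω, u x ≤ T) := by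
  obtain ⟨hu, hua, heq, hub, hlub⟩ := hs
  have hcpt : IsCompact (closure Ω) := hΩ.2.1.isCompact_closure
  have hne : (closure Ω).Nonempty := hΩ.2.2.closure
  have hdom : ∀ x ∈ Ω, u x ∈ domf a := fun x hx => hua x hx
  have hdomc : ∀ x ∈ closure Ω, u x ∈ domf a := fun x hx => by
    rcases mem_of_closure hΩ hx with h | h
    · exact hdom x h
    · rw [hub x h]; exact zero_mem_domf hf
  let v : EuclideanSpace ℝ (Fin n) → ℝ := fun x => - lap u x
  have hv : ContDiff ℝ (⊤ : ℕ∞) v := (lap_contDiff hu).neg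
  have hvb : ∀ x ∈ frontier Ω, v x = 0 := fun x hx => by simp [v, hlub x hx]
  have hlv : ∀ x ∈ Ω, - lap v x = lam * f (u x) := fun x hx => by
    rw [← heq x hx]
    have := lap_neg (lap_contDiff hu) x
    simp only [v]
    rw [this]; ring
  have hlfpos : ∀ x ∈ Ω, 0 < lam * f (u x) := fun x hx => mul_pos hlam (hf.pos _ (hdom x hx))
  have hv0 : ∀ x ∈ Ω, 0 ≤ v x := by
    intro y hy
    by_contra hcon
    push Not at hcon
    obtain ⟨x, hx, hmin⟩ := hcpt.exists_isMinOn hne hv.continuous.continuousOn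
    have hxy : v x ≤ v y := hmin (subset_closure hy)
    rcases mem_of_closure hΩ hx with h | h
    · have : IsLocalMin v x := by
        filter_upwards [hΩ.1.mem_nhds h] with z hz
        exact hmin (subset_closure hz)
      have := lap_nonneg_of_isLocalMin hv this
      have := hlv x h
      have := hlfpos x h
      linarith
    · rw [hvb x h] at hxy
      linarith
  have hu0 : ∀ x ∈ Ω, 0 < u x := by
    intro y hy
    rcases (hdom y hy).1.eq_or_lt with h | h
    · exfalso
      have h1 : IsLocalMin u y := by
        filter_upwards [hΩ.1.mem_nhds hy] with z hz
        rw [← h]; exact (hdom z hz).1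
      have h2 := lap_nonneg_of_isLocalMin hu h1
      have h3 : v y = 0 := le_antisymm (by simp only [v]; linarith) (hv0 y hy)
      have h4 : IsLocalMin v y := by
        filter_upwards [hΩ.1.mem_nhds hy] with z hz
        rw [h3]; exact hv0 z hz
      have := lap_nonneg_of_isLocalMin hv h4
      have := hlv y hy
      have := hlfpos y hy
      linarith
    · exact h
  refine ⟨v, hv, fun x => by simp [v], hvb, hlv, hu0, hdom, ?_, ?_⟩
  · intro y hy
    by_contra hcon
    push Not at hcon
    have hWc : ContinuousOn (fun x => √lam * Rf f (u x) - v x) (closure Ω) := by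
      refine (continuousOn_const.mul ?_).sub hv.continuous.continuousOn
      exact (Rf_contOn hf).comp hu.continuous.continuousOn hdomc
    obtain ⟨x, hx, hmax⟩ := hcpt.exists_isMaxOn hne hWc
    have hxy : √lam * Rf f (u y) - v y ≤ √lam * Rf f (u x) - v x := hmax (subset_closure hy)
    rcases mem_of_closure hΩ hx with h | h
    · have hsl : 0 < √lam := Real.sqrt_pos.2 hlam
      have hR := Rf_pos hf (hdom x h) (hu0 x h)
      have hft := ftil_pos hf (hdom x h) (hu0 x h)
      set b := ftil f (u x) / Rf f (u x) with hb
      have hloc : IsLocalMax (fun z => (√lam * b) * u z + (-1) * v z) x := by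
        filter_upwards [hΩ.1.mem_nhds h] with z hz
        have h1 : √lam * Rf f (u z) - v z ≤ √lam * Rf f (u x) - v x := hmax (subset_closure hz)
        have h2 := mul_le_mul_of_nonneg_left 
          (Rf_tangent hf (hdom x h) (hu0 x h) (hdom z hz)) hsl.le
        rw [← hb] at h2
        nlinarith
      have h3 := lap_nonpos_of_isLocalMax 
        ((contDiff_const.mul hu).add (contDiff_const.mul hv)) hloc
      rw [lap_lin hu hv] at h3
      have h4 : lap u x = - v x := by simp [v]
      have h5 := hlv x h
      have h6 : v x < √lam * Rf f (u x) := by linarith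
      have h7 : √lam * b * v x < √lam * b * (√lam * Rf f (u x)) := by
        have : 0 < b := by positivity
        gcongr
      have h8 : √lam * b * (√lam * Rf f (u x)) = lam * ftil f (u x) := by
        have : √lam * √lam = lam := Real.mul_self_sqrt hlam.le
        calc _ = (√lam * √lam) * (b * Rf f (u x)) := by ring
          _ = _ := by rw [this, hb, div_mul_cancel₀ _ hR.ne']
      have h9 : lam * ftil f (u x) < lam * f (u x) := by
        have := hf.f0_pos
        unfold ftil
        nlinarith
      rw [h4] at h3
      linarith
    · rw [hub x h, hvb x h] at hxy
      have : Rf f 0 = 0 := by simp [Rf, Ftil_zero]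
      rw [this] at hxy
      linarith
  · obtain ⟨x, hx, hmax⟩ := hcpt.exists_isMaxOn hne hu.continuous.continuousOn
    obtain ⟨y, hy⟩ := hΩ.2.2
    have h1 : u y ≤ u x := hmax (subset_closure hy)
    exact ⟨u x, hdomc x hx, (hu0 y hy).trans_le h1, fun z hz => hmax (subset_closure hz)⟩

lemma integrableOn_of_bdd {n : ℕ} {Ω : Set (EuclideanSpace ℝ (Fin n))} (hΩ : GoodDomain Ω)
    {h : EuclideanSpace ℝ (Fin n) → ℝ} (hm : AEStronglyMeasurable h (volume.restrict Ω)) (C : ℝ)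
    (hC : ∀ x ∈ Ω, |h x| ≤ C) : IntegrableOn h Ω := by
  have hc : IntegrableOn (fun _ : EuclideanSpace ℝ (Fin n) => C) Ω :=
    (continuousOn_const.integrableOn_compact hΩ.2.1.isCompact_closure).mono_set subset_closure
  refine Integrable.mono' hc hm ?_
  exact (ae_restrict_iff' hΩ.1.measurableSet).2 (Eventually.of_forall hC)

lemma integrableOn_of_cont {n : ℕ} {Ω : Set (EuclideanSpace ℝ (Fin n))} (hΩ : GoodDomain Ω)
    {w : EuclideanSpace ℝ (Fin n) → ℝ} (hw : Continuous w) : IntegrableOn w Ω :=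
  (hw.continuousOn.integrableOn_compact hΩ.2.1.isCompact_closure).mono_set subset_closure

/-- uniform `L¹` bound -/
lemma l1_bound {n : ℕ} {Ω : Set (EuclideanSpace ℝ (Fin n))} (hΩ : GoodDomain Ω)
    {a : EReal} {f : ℝ → ℝ} (hf : HypH a f) :
    ∃ U : ℝ, 0 ≤ U ∧ ∀ (lam : ℝ) (u : EuclideanSpace ℝ (Fin n) → ℝ), 0 < lam →
      Solves Ω a lam f u → Semistable Ω lam f u → ∫ x in Ω, u x ≤ U := by
  obtain ⟨K, hK, hKt⟩ := t_le hf
  refine ⟨K * volume.real Ω, by positivity, fun lam u hlam hs hst => ?_⟩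
  obtain ⟨v, hv, huv, hvb, hlv, hu0, hdom, hRv, T, hTd, hT0, hT⟩ := sol_facts hΩ hf hlam hs
  have hu := hs.1
  have hmeas := hΩ.1.measurableSet
  have hv0 : ∀ x ∈ Ω, 0 ≤ v x := fun x hx => 
    (mul_nonneg (Real.sqrt_nonneg _) (Real.sqrt_nonneg _)).trans (hRv x hx)
  have hst' := hst u hu hs.2.2.2.1
  have i1 : IntegrableOn (fun x => (lap u x) ^ 2) Ω := 
    integrableOn_of_cont hΩ ((lap_contDiff hu).continuous.pow 2)
  have i2 : IntegrableOn (fun x => lam * deriv f (u x) * u x ^ 2) Ω := by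
    refine integrableOn_of_bdd hΩ ?_ (lam * deriv f T * T ^ 2) fun x hx => ?_
    · refine Measurable.aestronglyMeasurable ?_
      exact (((measurable_deriv f).comp hu.continuous.measurable).const_mul lam).mul 
        (hu.continuous.measurable.pow_const 2)
    · have h1 := deriv_nn hf (hdom x hx) (hu0 x hx)
      have h2 := deriv_mono hf hTd (hu0 x hx) (hT x hx)
      have h3 := hT x hx
      have h4 := hu0 x hx
      have h5 : 0 ≤ deriv f T := deriv_nn hf hTd hT0
      rw [abs_of_nonneg (by positivity)]
      have h6 : u x ^ 2 ≤ T ^ 2 := by gcongr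
      have h7 : lam * deriv f (u x) ≤ lam * deriv f T := by gcongr
      exact mul_le_mul h7 h6 (by positivity) (by positivity)
  have i3 : IntegrableOn (fun x => u x * (- lap v x)) Ω := 
    integrableOn_of_cont hΩ (hu.continuous.mul (lap_contDiff hv).continuous.neg)
  rw [integral_sub i1 i2] at hst'
  have en := energy_le hΩ hu hv hvb hv0 (fun x hx => (hu0 x hx).le) (fun x _ => huv x)
    (fun x hx => by
      have := hlv x hx
      have := mul_pos hlam (hf.pos _ (hdom x hx))
      linarith)
  have e1 : ∫ x in Ω, (lap u x) ^ 2 = ∫ x in Ω, v x ^ 2 := by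
    refine setIntegral_congr_fun hmeas fun x _ => ?_
    simp only [huv x]; ring
  have i4 : IntegrableOn (fun x => lam * u x) Ω := integrableOn_of_cont hΩ (continuous_const.mul hu.continuous)
  have i5 : IntegrableOn (fun _ => lam * K) Ω := integrableOn_of_cont hΩ continuous_const
  have e2 : ∫ x in Ω, lam * u x ≤ ∫ x in Ω, (lam * K + (lam * deriv f (u x) * u x ^ 2 - u x * (- lap v x))) := by
    refine setIntegral_mono_on i4 (i5.add (i2.sub i3)) hmeas fun x hx => ?_
    rw [hlv x hx]
    have := mul_le_mul_of_nonneg_left (hKt _ (hdom x hx) (hu0 x hx)) hlam.le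
    nlinarith
  have i6 : IntegrableOn (fun x => lam * deriv f (u x) * u x ^ 2 - u x * (- lap v x)) Ω :=
    i2.sub i3
  rw [integral_add i5 i6, integral_sub i2 i3, integral_const_mul, setIntegral_const] at e2
  simp only [smul_eq_mul] at e2
  have e3 : lam * ∫ x in Ω, u x ≤ lam * (K * volume.real Ω) := by
    have : volume.real Ω * (lam * K) = lam * (K * volume.real Ω) := by ring
    linarith
  exact le_of_mul_le_mul_left e3 hlam

/-- uniform bound for the parameter -/
lemma lam_bound {n : ℕ} {Ω : Set (EuclideanSpace ℝ (Fin n))} (hΩ : GoodDomain Ω)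
    {a : EReal} {f : ℝ → ℝ} (hf : HypH a f) :
    ∃ Λ : ℝ, 0 < Λ ∧ ∀ (lam : ℝ) (u : EuclideanSpace ℝ (Fin n) → ℝ), 0 < lam →
      Solves Ω a lam f u → Semistable Ω lam f u → lam ≤ Λ := by
  obtain ⟨U, hU, hUb⟩ := l1_bound hΩ hf
  obtain ⟨x₀, hx₀⟩ := hΩ.2.2
  obtain ⟨r, hr, hball⟩ := Metric.isOpen_iff.1 hΩ.1 x₀ hx₀
  have hmeas := hΩ.1.measurableSet
  let b : ContDiffBump x₀ := ⟨r/4, r/2, by positivity, by linarith⟩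
  let ψ : EuclideanSpace ℝ (Fin n) → ℝ := b
  have hψ : ContDiff ℝ (⊤ : ℕ∞) ψ := b.contDiff
  have hc : HasCompactSupport ψ := b.hasCompactSupport
  have hts : tsupport ψ ⊆ Ω := by
    change tsupport b ⊆ Ω
    rw [b.tsupport_eq]
    refine (Metric.closedBall_subset_ball ?_).trans hball
    simp only [b]; linarith
  have hz : ∀ x ∉ tsupport ψ, lap ψ x = 0 := fun x hx => by
    have h0 : ψ =ᶠ[𝓝 x] fun _ => 0 := notMem_tsupport_iff_eventuallyEq.1 hx
    rw [lap_congr h0]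
    have := lap_lin (contDiff_const (c := (0:ℝ))) (contDiff_const (c := (0:ℝ))) 0 0 x
    simpa using this
  have hz2 : ∀ x ∉ tsupport ψ, lap (lap ψ) x = 0 := fun x hx => by
    have h0 : lap ψ =ᶠ[𝓝 x] fun _ => 0 := by
      filter_upwards [(isClosed_tsupport ψ).isOpen_compl.mem_nhds hx] with y hy
      exact hz y hy
    rw [lap_congr h0]
    have := lap_lin (contDiff_const (c := (0:ℝ))) (contDiff_const (c := (0:ℝ))) 0 0 x
    simpa using this
  have hc1 : HasCompactSupport (lap ψ) := HasCompactSupport.intro hc hz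
  have hc2 : HasCompactSupport (lap (lap ψ)) := HasCompactSupport.intro hc hz2
  have hl1 := lap_contDiff hψ
  have hl2 := lap_contDiff hl1
  obtain ⟨L, hL⟩ := hc2.exists_bound_of_continuous hl2.continuous
  have hL0 : 0 ≤ L := (norm_nonneg _).trans (hL x₀)
  have hP : 0 < ∫ x, ψ x := b.integral_pos
  have hf0 := hf.f0_pos
  refine ⟨L * U / (f 0 * ∫ x, ψ x) + 1, by positivity, fun lam u hlam hs hst => ?_⟩
  have hUu := hUb lam u hlam hs hst
  obtain ⟨v, hv, huv, hvb, hlv, hu0, hdom, hRv, T, hTd, hT0, hT⟩ := sol_facts hΩ hf hlam hs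
  have hu := hs.1
  have g1 := green_symm hv hψ hc
  have g2 := green_symm hu hl1 hc1
  have e1 : ∫ x, v x * lap ψ x = - ∫ x, lap ψ x * lap u x := by
    rw [← integral_neg]
    refine integral_congr_ae (Eventually.of_forall fun x => ?_)
    simp only [huv x]; ring
  have e2 : ∫ x, u x * lap (lap ψ) x ≤ L * U := by
    rw [← setIntegral_eq_integral_of_forall_compl_eq_zero (s := Ω) 
        (fun x hx => by rw [hz2 x (fun h => hx (hts h)), mul_zero])]
    calc ∫ x in Ω, u x * lap (lap ψ) x ≤ ∫ x in Ω, L * u x := by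
          refine setIntegral_mono_on (integrableOn_of_cont hΩ (hu.continuous.mul hl2.continuous))
            (integrableOn_of_cont hΩ (continuous_const.mul hu.continuous)) hmeas fun x hx => ?_
          rw [mul_comm]
          exact mul_le_mul_of_nonneg_right ((le_abs_self _).trans (hL x)) (hu0 x hx).le
      _ = L * ∫ x in Ω, u x := integral_const_mul _ _
      _ ≤ L * U := by gcongr
  have hψi : Integrable ψ := hψ.continuous.integrable_of_hasCompactSupport hc
  have e3 : lam * f 0 * ∫ x, ψ x ≤ - ∫ x, ψ x * lap v x := by
    rw [← integral_neg, ← integral_const_mul]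
    refine integral_mono (hψi.const_mul _) ?_ fun x => ?_
    · exact ((hψ.continuous.mul (lap_contDiff hv).continuous).integrable_of_hasCompactSupport 
        hc.mul_right).neg
    · by_cases hx : x ∈ Ω
      · have h1 := hlv x hx
        have h2 : 0 ≤ ψ x := b.nonneg
        have h3 : f 0 ≤ f (u x) := (hf.mono (zero_mem_domf hf) (hdom x hx) (hu0 x hx)).le
        have h4 : lam * f 0 ≤ - lap v x := by rw [h1]; gcongr
        simp only
        nlinarith
      · have : ψ x = 0 := image_eq_zero_of_notMem_tsupport fun h => hx (hts h)
        simp [this]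
  have e4 : lam * (f 0 * ∫ x, ψ x) ≤ L * U := by
    have : lam * (f 0 * ∫ x, ψ x) = lam * f 0 * ∫ x, ψ x := by ring
    linarith
  have : lam ≤ L * U / (f 0 * ∫ x, ψ x) := by
    rw [le_div_iff₀ (by positivity)]; exact e4
  linarith

/-- regularity of the composition with `f̃/√F`. -/
lemma g_facts {n : ℕ} {Ω : Set (EuclideanSpace ℝ (Fin n))} (hΩ : GoodDomain Ω)
    {a : EReal} {f : ℝ → ℝ} (hf : HypH a f) 
    {u : EuclideanSpace ℝ (Fin n) → ℝ} (hu : Continuous u) (hu0 : ∀ x ∈ Ω, 0 < u x) 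
    (hdom : ∀ x ∈ Ω, u x ∈ domf a) {T : ℝ} (hTd : T ∈ domf a) (hT : ∀ x ∈ Ω, u x ≤ T) :
    ContinuousOn (fun x => ftil f (u x) / √(Fint f (u x))) Ω ∧
    ∀ x ∈ Ω, 0 ≤ ftil f (u x) / √(Fint f (u x)) ∧ 
      ftil f (u x) / √(Fint f (u x)) ≤ 1 + 2 * deriv f T := by
  refine ⟨?_, fun x hx => ?_⟩
  · refine ContinuousOn.div ?_ ?_ ?_
    · exact (hf.smooth.continuousOn.comp hu.continuousOn hdom).sub continuousOn_const
    · refine ContinuousOn.sqrt ?_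
      simp_rw [Fint_eq]
      refine ContinuousOn.add ?_ (continuousOn_const.mul hu.continuousOn)
      exact (Ftil_contOn hf hTd).comp hu.continuousOn fun x hx => ⟨(hu0 x hx).le, hT x hx⟩
    · intro x hx
      have h1 := Ftil_pos hf (hdom x hx) (hu0 x hx)
      have h2 := hu0 x hx
      have h3 := hf.f0_pos
      refine (Real.sqrt_pos.2 ?_).ne'
      rw [Fint_eq]; positivity
  · refine ⟨div_nonneg (ftil_pos hf (hdom x hx) (hu0 x hx)).le (Real.sqrt_nonneg _), ?_⟩
    have h1 := g_sq_le hf (hdom x hx) (hu0 x hx)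
    have h2 := deriv_mono hf hTd (hu0 x hx) (hT x hx)
    nlinarith [sq_nonneg (ftil f (u x) / √(Fint f (u x)) - 1)]

lemma small_pow {θ : ℝ} (hθ : 0 < θ) {A ε : ℝ} (hA : 0 ≤ A) (hε : 0 < ε) :
    ∃ S : ℝ, 0 < S ∧ S ^ θ * A ≤ ε := by
  refine ⟨(ε / (A + 1)) ^ (1 / θ), by positivity, ?_⟩
  rw [← Real.rpow_mul (by positivity), one_div_mul_cancel hθ.ne', Real.rpow_one, div_mul_eq_mul_div,
    div_le_iff₀ (by positivity)]
  nlinarith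

/-- Estimates for a single solution. -/
lemma core {n : ℕ} {Ω : Set (EuclideanSpace ℝ (Fin n))} (hΩ : GoodDomain Ω)
    {a : EReal} {f : ℝ → ℝ} (hf : HypH a f) {q : ℝ} (hq : 1 ≤ q) (hnq : (n : ℝ) < 2 * q)
    {c : ℝ} (hc : 0 < c) 
    (hfc : ∀ t ∈ domf a, 0 < t → f t ≤ c * (1 + ftil f t / √(Fint f t)) * (1 + Rf f t))
    {lam : ℝ} (hlam : 0 < lam) {u : EuclideanSpace ℝ (Fin n) → ℝ} (hs : Solves Ω a lam f u)
    {U L D : ℝ} (hU : ∫ x in Ω, u x ≤ U) (hL : √lam ≤ L) (hD1 : 1 ≤ D)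
    (hD : volume.real Ω + ∫ x in Ω, |ftil f (u x) / √(Fint f (u x))| ^ q ≤ D) :
    ∃ N V E : ℝ, 1 ≤ N ∧ (∀ x ∈ Ω, Rf f (u x) ≤ N) ∧
      (∀ S : ℝ, 0 < S → (∫ y, gau (n := n) y) * (N - 1) ≤ (S ^ n)⁻¹ * V +
        (((∫ y, gau (n := n) y) + 1) / (2 - n / q)) * S ^ (2 - n / q) * (2 * L * c * N * D)) ∧
      (∀ S : ℝ, 0 < S → ∀ x ∈ Ω, (∫ y, gau (n := n) y) * u x ≤ (S ^ n)⁻¹ * U +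
        (((∫ y, gau (n := n) y) + 1) / (2 - n / q)) * S ^ (2 - n / q) * (L * N * D)) ∧
      (∀ A : ℝ, 0 ≤ A → (∀ x ∈ Ω, u x ≤ A) → E ≤ A * (c * N * (2 * D))) ∧
      (∀ κ : ℝ, 0 < κ → V ≤ κ * E + volume.real Ω / (4 * κ)) := by
  obtain ⟨v, hv, huv, hvb, hlv, hu0, hdom, hRv, T, hTd, hT0, hT⟩ := sol_facts hΩ hf hlam hs
  have hu := hs.1
  have hmeas := hΩ.1.measurableSet
  have hq0 : 0 < q := by linarith
  have hsl : 0 < √lam := Real.sqrt_pos.2 hlam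
  have hsl2 : √lam * √lam = lam := Real.mul_self_sqrt hlam.le
  have hL0 : 0 < L := hsl.trans_le hL
  have hD0 : 0 < D := by linarith
  have hDq : D ≤ D ^ q := by
    calc D = D ^ (1:ℝ) := (Real.rpow_one D).symm
      _ ≤ D ^ q := Real.rpow_le_rpow_of_exponent_le hD1 hq
  have hvpos : ∀ x ∈ Ω, 0 < v x := fun x hx =>
    (mul_pos hsl (Rf_pos hf (hdom x hx) (hu0 x hx))).trans_le (hRv x hx)
  -- maximizer
  obtain ⟨x₁, hx₁, hmax⟩ := hΩ.2.1.isCompact_closure.exists_isMaxOn hΩ.2.2.closure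
    hv.continuous.continuousOn
  have hx₁' : x₁ ∈ Ω := by
    rcases mem_of_closure hΩ hx₁ with h | h
    · exact h
    · exfalso
      obtain ⟨y, hy⟩ := hΩ.2.2
      have h1 : v y ≤ v x₁ := hmax (subset_closure hy)
      have h2 := hvpos y hy
      rw [hvb x₁ h] at h1
      linarith
  have hM : ∀ x ∈ Ω, v x ≤ v x₁ := fun x hx => hmax (subset_closure hx)
  set M := v x₁ / √lam with hMdef
  have hM0 : 0 < M := div_pos (hvpos x₁ hx₁') hsl
  have hMv : v x₁ = √lam * M := by rw [hMdef]; field_simp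
  have hRM : ∀ x ∈ Ω, Rf f (u x) ≤ M := fun x hx => by
    rw [hMdef, le_div_iff₀ hsl, mul_comm]
    exact (hRv x hx).trans (hM x hx)
  obtain ⟨hgc, hgb⟩ := g_facts hΩ hf hu.continuous hu0 hdom hTd hT
  set g : EuclideanSpace ℝ (Fin n) → ℝ := fun x => ftil f (u x) / √(Fint f (u x)) with hg
  have hg0 : ∀ x ∈ Ω, 0 ≤ g x := fun x hx => (hgb x hx).1
  have hgB : ∀ x ∈ Ω, g x ≤ 1 + 2 * deriv f T := fun x hx => (hgb x hx).2
  have hdT : 0 ≤ deriv f T := deriv_nn hf hTd hT0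
  set G := ∫ x in Ω, |ftil f (u x) / √(Fint f (u x))| ^ q with hGdef
  have hGeq : G = ∫ x in Ω, g x ^ q := by
    refine setIntegral_congr_fun hmeas fun x hx => ?_
    have h1 : |g x| = g x := abs_of_nonneg (hg0 x hx)
    change |g x| ^ q = g x ^ q
    rw [h1]
  have ibd : ∀ w : EuclideanSpace ℝ (Fin n) → ℝ, ContinuousOn w Ω → ∀ C : ℝ,
      (∀ x ∈ Ω, |w x| ≤ C) → IntegrableOn w Ω := fun w hw C hC =>
    integrableOn_of_bdd hΩ (hw.aestronglyMeasurable hmeas) C hC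
  have ig : IntegrableOn g Ω := ibd g hgc _ fun x hx => by
    rw [abs_of_nonneg (hg0 x hx)]; exact hgB x hx
  have igq : IntegrableOn (fun x => g x ^ q) Ω := by
    refine ibd _ (hgc.rpow_const fun x _ => Or.inr hq0.le) ((1 + 2 * deriv f T) ^ q) fun x hx => ?_
    rw [abs_of_nonneg (Real.rpow_nonneg (hg0 x hx) _)]
    exact Real.rpow_le_rpow (hg0 x hx) (hgB x hx) hq0.le
  have ic : ∀ r : ℝ, IntegrableOn (fun _ : EuclideanSpace ℝ (Fin n) => r) Ω := fun r =>
    integrableOn_of_cont hΩ continuous_const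
  have hW0 : 0 ≤ volume.real Ω := measureReal_nonneg
  have hG0 : 0 ≤ G := by
    rw [hGeq]; exact setIntegral_nonneg hmeas fun x hx => Real.rpow_nonneg (hg0 x hx) _
  have hWD : volume.real Ω ≤ D := by linarith
  set N := 1 + M with hN
  have hN1 : 1 ≤ N := by linarith
  have hN0 : 0 < N := by linarith
  have hfN : ∀ x ∈ Ω, f (u x) ≤ c * N * (1 + g x) := fun x hx => by
    have h1 := hfc _ (hdom x hx) (hu0 x hx)
    have h2 := hRM x hx
    have h3 := hg0 x hx
    calc f (u x) ≤ c * (1 + g x) * (1 + Rf f (u x)) := h1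
      _ ≤ c * (1 + g x) * N := by rw [hN]; gcongr
      _ = _ := by ring
  have i1g : ∫ x in Ω, (1 + g x) ≤ 2 * D := by
    have h1 : ∫ x in Ω, (1 + g x) ≤ ∫ x in Ω, (2 + g x ^ q) := by
      refine setIntegral_mono_on ((ic 1).add ig) ((ic 2).add igq) hmeas fun x hx => ?_
      have h2 := hg0 x hx
      rcases le_total (g x) 1 with h | h
      · have := Real.rpow_nonneg h2 q
        linarith
      · have : g x ≤ g x ^ q := by
          calc g x = g x ^ (1:ℝ) := (Real.rpow_one _).symm
            _ ≤ _ := Real.rpow_le_rpow_of_exponent_le h hq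
        linarith
    rw [integral_add (ic 2) igq, setIntegral_const, ← hGeq, smul_eq_mul] at h1
    linarith
  refine ⟨N, (∫ x in Ω, v x) / √lam, (∫ x in Ω, v x ^ 2) / lam, hN1,
    fun x hx => (hRM x hx).trans (by linarith), ?_, ?_, ?_, ?_⟩
  · intro S hS
    set k := √lam * (L * c * N) with hk
    have hk0 : 0 < k := by positivity
    have hle : ∀ x ∈ Ω, (k * (1 + g x)) ^ q ≤ (2 * k) ^ q * (1 + g x ^ q) := fun x hx => by
      have h2 := hg0 x hx
      have h3 : (1 + g x) ^ q ≤ 2 ^ q * (1 + g x ^ q) := by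
        have h4 := Real.rpow_nonneg h2 q
        have h5 : (0:ℝ) ≤ 2 ^ q := by positivity
        rcases le_total (g x) 1 with h | h
        · calc (1 + g x) ^ q ≤ 2 ^ q := Real.rpow_le_rpow (by linarith) (by linarith) hq0.le
            _ ≤ _ := by nlinarith
        · calc (1 + g x) ^ q ≤ (2 * g x) ^ q :=
                Real.rpow_le_rpow (by linarith) (by linarith) hq0.le
            _ = 2 ^ q * g x ^ q := Real.mul_rpow (by norm_num) h2
            _ ≤ _ := by nlinarith
      rw [Real.mul_rpow hk0.le (by linarith), Real.mul_rpow (by norm_num) hk0.le]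
      have : 0 ≤ k ^ q := by positivity
      nlinarith
    have hintg : IntegrableOn (fun x => (k * (1 + g x)) ^ q) Ω := by
      refine ibd _ ((continuousOn_const.mul (continuousOn_const.add hgc)).rpow_const
        fun x _ => Or.inr hq0.le) ((k * (1 + (1 + 2 * deriv f T))) ^ q) fun x hx => ?_
      have h2 := hg0 x hx
      have h3 := hgB x hx
      rw [abs_of_nonneg (by positivity)]
      gcongr
    have i7 : IntegrableOn (fun x => 1 + g x ^ q) Ω := (ic 1).add igq
    have hJ : ∫ x in Ω, (k * (1 + g x)) ^ q ≤ (2 * k * D) ^ q := by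
      calc ∫ x in Ω, (k * (1 + g x)) ^ q ≤ ∫ x in Ω, (2 * k) ^ q * (1 + g x ^ q) :=
            setIntegral_mono_on hintg (i7.const_mul _) hmeas hle
        _ = (2 * k) ^ q * (volume.real Ω + G) := by
            rw [integral_const_mul, integral_add (ic 1) igq, setIntegral_const, ← hGeq,
              smul_eq_mul, mul_one]
        _ ≤ (2 * k) ^ q * D ^ q := by
            have := hD.trans hDq
            gcongr
        _ = _ := (Real.mul_rpow (by positivity) hD0.le).symm
    have key := sup_est hΩ hq hnq hv hvb (fun x hx => (hvpos x hx).le)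
      (h := fun x => k * (1 + g x)) (fun x hx => by have := hg0 x hx; positivity)
      (fun x hx => by
        have h1 := hfN x hx
        have h2 := hg0 x hx
        rw [hlv x hx]
        calc lam * f (u x) ≤ lam * (c * N * (1 + g x)) := by gcongr
          _ = √lam * (√lam * (c * N)) * (1 + g x) := by
            calc _ = (√lam * √lam) * (c * N * (1 + g x)) := by rw [hsl2]
              _ = _ := by ring
          _ ≤ √lam * (L * (c * N)) * (1 + g x) := by gcongr
          _ = _ := by rw [hk]; ring) hintg (by positivity : 0 < 2 * k * D) hJ hx₁' hS
    rw [hMv] at key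
    have e : N - 1 = M := by rw [hN]; ring
    rw [e]
    refine le_of_mul_le_mul_left (a := √lam) ?_ hsl
    calc √lam * ((∫ y, gau (n := n) y) * M) = (∫ y, gau (n := n) y) * (√lam * M) := by ring
      _ ≤ _ := key
      _ = _ := by
        have : ∫ x in Ω, v x = √lam * ((∫ x in Ω, v x) / √lam) := by field_simp
        rw [this, hk]
        field_simp
  · intro S hS x hx
    have key := sup_est hΩ hq hnq hu hs.2.2.2.1 (fun x hx => (hu0 x hx).le)
      (h := fun _ => L * N) (fun x hx => by positivity)
      (fun x hx => by
        rw [huv x, neg_neg]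
        calc v x ≤ √lam * M := (hM x hx).trans_eq hMv
          _ ≤ L * N := by 
            have : M ≤ N := by linarith
            gcongr) (ic _) (by positivity : 0 < L * N * D) (by
        rw [setIntegral_const, smul_eq_mul, Real.mul_rpow (by positivity) hD0.le, mul_comm]
        have := hWD.trans hDq
        gcongr) hx hS
    refine key.trans ?_
    gcongr
  · intro A hA hAu
    have en := energy_le hΩ hu hv hvb (fun x hx => (hvpos x hx).le) (fun x hx => (hu0 x hx).le)
      (fun x _ => huv x)
      (fun x hx => by
        have := hlv x hx
        have := mul_pos hlam (hf.pos _ (hdom x hx))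
        linarith)
    rw [div_le_iff₀ hlam]
    have i7 : IntegrableOn (fun x => 1 + g x) Ω := (ic 1).add ig
    calc ∫ x in Ω, v x ^ 2 ≤ _ := en
      _ ≤ ∫ x in Ω, (A * (lam * (c * N))) * (1 + g x) := by
        refine setIntegral_mono_on (integrableOn_of_cont hΩ 
          (hu.continuous.mul (lap_contDiff hv).continuous.neg)) (i7.const_mul _) hmeas fun x hx => ?_
        rw [hlv x hx]
        have h1 := hfN x hx
        have h2 := hAu x hx
        have h3 := hf.pos _ (hdom x hx)
        calc u x * (lam * f (u x)) ≤ A * (lam * (c * N * (1 + g x))) := by gcongr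
          _ = _ := by ring
      _ = (A * (lam * (c * N))) * ∫ x in Ω, (1 + g x) := integral_const_mul _ _
      _ ≤ (A * (lam * (c * N))) * (2 * D) := by gcongr
      _ = _ := by ring
  · intro κ hκ
    have iv2 : IntegrableOn (fun x => κ / lam * v x ^ 2) Ω :=
      integrableOn_of_cont hΩ (continuous_const.mul (hv.continuous.pow 2))
    have h1 : ∫ x in Ω, v x / √lam ≤ ∫ x in Ω, (κ / lam * v x ^ 2 + 1 / (4 * κ)) := by
      refine setIntegral_mono_on (integrableOn_of_cont hΩ (hv.continuous.div_const _))
        (iv2.add (ic _)) hmeas fun x hx => ?_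
      have e : κ / lam * v x ^ 2 = κ * (v x / √lam) ^ 2 := by
        rw [div_pow, Real.sq_sqrt hlam.le]; ring
      rw [e]
      have : κ * (v x / √lam) ^ 2 + 1 / (4 * κ) - v x / √lam
          = κ * (v x / √lam - 1 / (2 * κ)) ^ 2 := by field_simp; ring
      have h2 : 0 ≤ κ * (v x / √lam - 1 / (2 * κ)) ^ 2 := by positivity
      linarith
    rw [integral_add iv2 (ic _), setIntegral_const, integral_const_mul, integral_div,
      smul_eq_mul] at h1
    refine h1.trans_eq ?_
    ring

set_option maxHeartbeats 1000000 in
lemma main1 {n : ℕ} {Ω : Set (EuclideanSpace ℝ (Fin n))} (hΩ : GoodDomain Ω)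
    {a : EReal} {f : ℝ → ℝ} (hf : HypH a f)
    (hF : a ≠ ⊤ → Filter.Tendsto (Fint f) (afFilter a) Filter.atTop)
    {lam : ℕ → ℝ} (hlam : ∀ m, 0 < lam m)
    {u : ℕ → EuclideanSpace ℝ (Fin n) → ℝ}
    (hsol : ∀ m, Solves Ω a (lam m) f (u m))
    (hsemi : ∀ m, Semistable Ω (lam m) f (u m))
    {q : ℝ} (hq : 1 ≤ q) {C : ℝ}
    (hC : ∀ m, ∫ x in Ω, |ftil f (u m x) / √(Fint f (u m x))| ^ q ≤ C)
    (hnq : (n : ℝ) < 2 * q) : ∃ C : ℝ, (C : EReal) < a ∧ ∀ m, ∀ x ∈ Ω, u m x ≤ C := by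
  obtain ⟨U, hU, hUb⟩ := l1_bound hΩ hf
  obtain ⟨Λ, hΛ, hΛb⟩ := lam_bound hΩ hf
  obtain ⟨c, hc, hfc⟩ := f_le hf
  set L := √Λ + 1 with hLdef
  have hL0 : 0 < L := by positivity
  set W := volume.real Ω with hW
  have hW0 : 0 ≤ W := measureReal_nonneg
  set D := W + max C 0 + 1 with hDdef
  have hCm : 0 ≤ max C 0 := le_max_right _ _
  have hD1 : 1 ≤ D := by linarith
  have hD0 : 0 < D := by linarith
  set Z := ∫ y, gau (n := n) y with hZ
  have hZ0 : 0 < Z := gau_integral_pos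
  set θ := 2 - (n : ℝ) / q with hθ
  have hθ0 : 0 < θ := by
    have : (n : ℝ) / q < 2 := by rw [div_lt_iff₀ (by linarith)]; linarith
    linarith
  set c0 := (Z + 1) / θ with hc0
  have hc00 : 0 < c0 := by positivity
  obtain ⟨S1, hS1, hS1b⟩ := small_pow hθ0 (A := c0 * (2 * L * c * D)) (ε := Z / 2) (by positivity)
    (by positivity)
  set a1 := (2 / Z) * (S1 ^ n)⁻¹ with ha1
  have ha10 : 0 < a1 := by positivity
  set k := a1 * W + 1 with hk
  have hk0 : 0 < k := by positivity
  set P := a1 * k * (c * (2 * D)) with hP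
  have hP0 : 0 < P := by positivity
  obtain ⟨S2, hS2, hS2b⟩ := small_pow hθ0 (A := P * (c0 * (L * D))) (ε := Z / 4) (by positivity)
    (by positivity)
  set Cd := (S2 ^ n)⁻¹ * U / Z with hCd
  have hCd0 : 0 ≤ Cd := by positivity
  set δ := c0 * S2 ^ θ * (L * D) / Z with hδ
  have hδ0 : 0 < δ := by positivity
  have hPδ : P * δ ≤ 1 / 4 := by
    rw [hδ, mul_div_assoc', div_le_iff₀ hZ0]
    calc _ = S2 ^ θ * (P * (c0 * (L * D))) := by ring
      _ ≤ _ := hS2b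
      _ = _ := by ring
  set B := 4 + 2 * (P * Cd) with hB
  obtain ⟨C1, hC1a, hC1⟩ := Ftil_bdd hf hF (B ^ 2 / 2)
  refine ⟨C1, hC1a, fun m x hx => ?_⟩
  have hlm : √(lam m) ≤ L := by
    have := Real.sqrt_le_sqrt (hΛb _ _ (hlam m) (hsol m) (hsemi m))
    linarith
  obtain ⟨N, V, E, hN1, hRN, hest1, hest2, hest3, hest4⟩ := core hΩ hf hq hnq hc hfc (hlam m)
    (hsol m) (hUb _ _ (hlam m) (hsol m) (hsemi m)) hlm hD1 (by
      have h1 := hC m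
      have h2 := le_max_left C 0
      linarith)
  have hN0 : 0 < N := by linarith
  have h1 := hest1 S1 hS1
  have h2 : N ≤ 2 + a1 * V := by
    have h3 : c0 * S1 ^ θ * (2 * L * c * N * D) ≤ Z / 2 * N := by
      calc _ = S1 ^ θ * (c0 * (2 * L * c * D)) * N := by ring
        _ ≤ _ := by gcongr
    have h4 : Z * (N - 1) ≤ (S1 ^ n)⁻¹ * V + Z / 2 * N := by linarith
    have h5 : Z * N ≤ Z * (2 + a1 * V) := by
      have : Z * (a1 * V) = 2 * ((S1 ^ n)⁻¹ * V) := by rw [ha1]; field_simp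
      linarith
    exact le_of_mul_le_mul_left h5 hZ0
  have h3 : ∀ y ∈ Ω, u m y ≤ Cd + δ * N := fun y hy => by
    have h4 := hest2 S2 hS2 y hy
    refine le_of_mul_le_mul_left (a := Z) ?_ hZ0
    calc Z * u m y ≤ (S2 ^ n)⁻¹ * U + c0 * S2 ^ θ * (L * N * D) := h4
      _ = _ := by
        have e1 : Z * Cd = (S2 ^ n)⁻¹ * U := by rw [hCd]; field_simp
        have e2 : Z * δ = c0 * S2 ^ θ * (L * D) := by rw [hδ]; field_simp
        calc _ = (S2 ^ n)⁻¹ * U + (c0 * S2 ^ θ * (L * D)) * N := by ring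
          _ = _ := by rw [← e1, ← e2]; ring
  have h4 := hest3 (Cd + δ * N) (by positivity) h3
  have h5 := hest4 (k / N) (by positivity)
  have h6 : a1 * V ≤ P * (Cd + δ * N) + N / 4 := by
    have h7 : k / N * E ≤ k * (c * (2 * D)) * (Cd + δ * N) := by
      calc k / N * E ≤ k / N * ((Cd + δ * N) * (c * N * (2 * D))) := by gcongr
        _ = _ := by field_simp
    have h8 : a1 * (W / (4 * (k / N))) ≤ N / 4 := by
      have : a1 * (W / (4 * (k / N))) = (a1 * W) / k * (N / 4) := by field_simp
      rw [this]
      have : a1 * W / k ≤ 1 := by rw [div_le_one hk0]; linarith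
      have h9 : 0 ≤ N / 4 := by positivity
      exact mul_le_of_le_one_left h9 this
    calc a1 * V ≤ a1 * (k / N * E + W / (4 * (k / N))) := by gcongr
      _ = a1 * (k / N * E) + a1 * (W / (4 * (k / N))) := by ring
      _ ≤ a1 * (k * (c * (2 * D)) * (Cd + δ * N)) + N / 4 := by gcongr
      _ = _ := by rw [hP]; ring
  have h7 : N ≤ B := by
    have : P * δ * N ≤ 1 / 4 * N := by gcongr
    have e : P * (Cd + δ * N) = P * Cd + P * δ * N := by ring
    linarith
  obtain ⟨v, hv, huv, hvb, hlv, hu0, hdom, -⟩ := sol_facts hΩ hf (hlam m) (hsol m)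
  refine hC1 _ (hdom x hx) ?_
  have h8 := Rf_sq hf (hdom x hx)
  have h9 := Rf_pos hf (hdom x hx) (hu0 x hx)
  have h10 := (hRN x hx).trans h7
  have : Rf f (u m x) ^ 2 ≤ B ^ 2 := by gcongr
  linarith

lemma main2 {n : ℕ} {Ω : Set (EuclideanSpace ℝ (Fin n))} (hΩ : GoodDomain Ω)
    {a : EReal} {f : ℝ → ℝ} (hf : HypH a f) {lam : ℝ} (hlam : 0 < lam)
    {u : EuclideanSpace ℝ (Fin n) → ℝ} (hs : Solves Ω a lam f u)
    {q : ℝ} (hq : 1 ≤ q) {C : ℝ} (hC : ∫ x in Ω, |deriv f (u x)| ^ q ≤ C) :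
    ∫ x in Ω, |ftil f (u x) / √(Fint f (u x))| ^ (2 * q) ≤ 2 ^ q * C := by
  obtain ⟨v, hv, huv, hvb, hlv, hu0, hdom, hRv, T, hTd, hT0, hT⟩ := sol_facts hΩ hf hlam hs
  have hu := hs.1
  have hmeas := hΩ.1.measurableSet
  have hq0 : 0 < q := by linarith
  obtain ⟨hgc, hgb⟩ := g_facts hΩ hf hu.continuous hu0 hdom hTd hT
  have i1 : IntegrableOn (fun x => |ftil f (u x) / √(Fint f (u x))| ^ (2 * q)) Ω := by
    refine integrableOn_of_bdd hΩ ((hgc.abs.rpow_const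
      fun x _ => Or.inr (by positivity)).aestronglyMeasurable hmeas)
      ((1 + 2 * deriv f T) ^ (2 * q)) fun x hx => ?_
    rw [abs_of_nonneg (by positivity), abs_of_nonneg (hgb x hx).1]
    exact Real.rpow_le_rpow (hgb x hx).1 (hgb x hx).2 (by positivity)
  have i2 : IntegrableOn (fun x => |deriv f (u x)| ^ q) Ω := by
    refine integrableOn_of_bdd hΩ ?_ ((deriv f T) ^ q) fun x hx => ?_
    · exact ((((measurable_deriv f).comp hu.continuous.measurable).abs).pow_const
        q).aestronglyMeasurable
    · have h1 := deriv_nn hf (hdom x hx) (hu0 x hx)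
      have h2 := deriv_mono hf hTd (hu0 x hx) (hT x hx)
      rw [abs_of_nonneg (by positivity), abs_of_nonneg h1]
      exact Real.rpow_le_rpow h1 h2 (by positivity)
  calc _ ≤ ∫ x in Ω, 2 ^ q * |deriv f (u x)| ^ q := by
        refine setIntegral_mono_on i1 (i2.const_mul _) hmeas fun x hx => ?_
        have h1 := deriv_nn hf (hdom x hx) (hu0 x hx)
        have h2 := g_sq_le hf (hdom x hx) (hu0 x hx)
        rw [Real.rpow_mul (abs_nonneg _), ← Real.mul_rpow (by norm_num) (abs_nonneg _)]
        refine Real.rpow_le_rpow (by positivity) ?_ hq0.le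
        rw [abs_of_nonneg h1, Real.rpow_two, sq_abs]
        exact h2
    _ = 2 ^ q * ∫ x in Ω, |deriv f (u x)| ^ q := integral_const_mul _ _
    _ ≤ _ := by gcongr

/-- **Proposition 2.2.** Under (H) (assuming `F(t) → ∞` as `t → a_f` in the singular case),
for a sequence `(u_m)` of semistable solutions of `(N_{λ_m})`:
if `‖f̃(u_m)/√F(u_m)‖_{L^q}` is uniformly bounded for some `q ≥ 1` then
`sup_m ‖u_m‖_{L^∞} < a_f` for `n < 2q`; and if `‖f'(u_m)‖_{L^q}` is uniformly bounded then
the same holds for `n < 4q`. -/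
theorem statement7 {n : ℕ} (Ω : Set (EuclideanSpace ℝ (Fin n))) (hΩ : GoodDomain Ω)
    (a : EReal) (f : ℝ → ℝ) (hf : HypH a f)
    (hF : a ≠ ⊤ → Filter.Tendsto (Fint f) (afFilter a) Filter.atTop)
    (lam : ℕ → ℝ) (hlam : ∀ m, 0 < lam m)
    (u : ℕ → EuclideanSpace ℝ (Fin n) → ℝ)
    (hsol : ∀ m, Solves Ω a (lam m) f (u m))
    (hsemi : ∀ m, Semistable Ω (lam m) f (u m))
    (q : ℝ) (hq : 1 ≤ q) :
    ((∃ C : ℝ, ∀ m, ∫ x in Ω, |ftil f (u m x) / Real.sqrt (Fint f (u m x))| ^ q ≤ C) →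
      (n : ℝ) < 2 * q → ∃ C : ℝ, (C : EReal) < a ∧ ∀ m, ∀ x ∈ Ω, u m x ≤ C) ∧
    ((∃ C : ℝ, ∀ m, ∫ x in Ω, |deriv f (u m x)| ^ q ≤ C) →
      (n : ℝ) < 4 * q → ∃ C : ℝ, (C : EReal) < a ∧ ∀ m, ∀ x ∈ Ω, u m x ≤ C) := by
  refine ⟨fun ⟨C, hC⟩ hn => main1 hΩ hf hF hlam hsol hsemi hq hC hn, fun ⟨C, hC⟩ hn => ?_⟩
  exact main1 hΩ hf hF hlam hsol hsemi (q := 2 * q) (by linarith) (C := 2 ^ q * C)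
    (fun m => main2 hΩ hf (hlam m) (hsol m) hq (hC m)) (by linarith)

end
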